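/- arXiv:1901.04036 — 4 statements merged into one kernel-verified Lean document; each statement's English description precedes it below -/
import Mathlib

section
/- Let l, w be positive integers and i ∈ {1,2}. If Σ = {e₁,…,e_n} ⊆ E^{(i)}_{l,w} is a mincut of the hammock network H^{(i)}_{l,w}, then the set of complementary edges Σ̄ = {ē₁,…,ē_n} is a minpath of the dual network H̄^{(i)}_{l,w}. -/
open scoped Classical

/-- Parity predicate: kind 1 = even points (x+y even), kind 2 = odd points. -/
def HammockPar (i : ℕ) (p : ℤ × ℤ) : Prop :=
  if i = 1 then Even (p.1 + p.2) else Odd (p.1 + p.2)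

/-- The set 𝒱_{l,w} of lattice points of the rectangle [0,l] × [0,w]. -/
def HammockVAll (l w : ℕ) : Set (ℤ × ℤ) :=
  {p | 0 ≤ p.1 ∧ p.1 ≤ (l : ℤ) ∧ 0 ≤ p.2 ∧ p.2 ≤ (w : ℤ)}

/-- The vertex set V^{(i)}_{l,w} of the hammock network of kind `i`. -/
def HammockV (i l w : ℕ) : Set (ℤ × ℤ) :=
  {p | p ∈ HammockVAll l w ∧ HammockPar i p}

/-- The set 𝓔_{l,w} of all diagonal unit edges inside the rectangle. -/
def HammockEAll (l w : ℕ) : Set (Sym2 (ℤ × ℤ)) :=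
  {e | ∃ a b : ℤ × ℤ, e = s(a, b) ∧ a ∈ HammockVAll l w ∧ b ∈ HammockVAll l w ∧
      |a.1 - b.1| = 1 ∧ |a.2 - b.2| = 1}

/-- The edge set E^{(i)}_{l,w} of the hammock network of kind `i`. -/
def HammockE (i l w : ℕ) : Set (Sym2 (ℤ × ℤ)) :=
  {e | e ∈ HammockEAll l w ∧ ∀ p ∈ e, HammockPar i p}

/-- The allowed steps of an X-path. -/
def XStep : Set (ℤ × ℤ) := {(1, 1), (-1, 1), (1, -1), (-1, -1)}

/-- An X-path: a finite sequence of pairwise distinct lattice points, each obtained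
from the previous one by a step in `XStep`. -/
def IsXPath (vs : List (ℤ × ℤ)) : Prop :=
  vs.Nodup ∧ vs.Chain' (fun a b => b - a ∈ XStep)

/-- The list of edges of an X-path. -/
def xEdges (vs : List (ℤ × ℤ)) : List (Sym2 (ℤ × ℤ)) :=
  (vs.zip vs.tail).map fun q => s(q.1, q.2)

/-- A two-terminal network on the diagonal lattice: an edge set together with
a set of source nodes and a set of terminus nodes. -/
structure HNetwork where
  edges : Set (Sym2 (ℤ × ℤ))
  src : Set (ℤ × ℤ)
  tgt : Set (ℤ × ℤ)

/-- `P` is a pathset: `P ⊆ edges` and `P` contains all edges of some X-path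
joining a source node to a terminus node. -/
def HNetwork.IsPathset (N : HNetwork) (P : Set (Sym2 (ℤ × ℤ))) : Prop :=
  P ⊆ N.edges ∧ ∃ (vs : List (ℤ × ℤ)) (h : vs ≠ []),
    IsXPath vs ∧ vs.head h ∈ N.src ∧ vs.getLast h ∈ N.tgt ∧ ∀ e ∈ xEdges vs, e ∈ P

/-- `C` is a cutset: removing `C` leaves no pathset. -/
def HNetwork.IsCutset (N : HNetwork) (C : Set (Sym2 (ℤ × ℤ))) : Prop :=
  C ⊆ N.edges ∧ ¬ N.IsPathset (N.edges \ C)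

/-- A minpath: a pathset no proper subset of which is a pathset. -/
def HNetwork.IsMinpath (N : HNetwork) (P : Set (Sym2 (ℤ × ℤ))) : Prop :=
  N.IsPathset P ∧ ∀ Q, Q ⊂ P → ¬ N.IsPathset Q

/-- A mincut: a cutset no proper subset of which is a cutset. -/
def HNetwork.IsMincut (N : HNetwork) (C : Set (Sym2 (ℤ × ℤ))) : Prop :=
  N.IsCutset C ∧ ∀ D, D ⊂ C → ¬ N.IsCutset D

/-- The hammock network H^{(i)}_{l,w}: sources are its vertices with x = 0,
terminals its vertices with x = l. -/
def hammock (i l w : ℕ) : HNetwork where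
  edges := HammockE i l w
  src := {p | p ∈ HammockV i l w ∧ p.1 = 0}
  tgt := {p | p ∈ HammockV i l w ∧ p.1 = (l : ℤ)}

/-- The dual network H̄^{(i)}_{l,w}: vertex set 𝒱 − V^{(i)}, edge set 𝓔 − E^{(i)},
sources the points with y = 0, terminals the points with y = w. -/
def hammockDual (i l w : ℕ) : HNetwork where
  edges := HammockEAll l w \ HammockE i l w
  src := {p | p ∈ HammockVAll l w \ HammockV i l w ∧ p.2 = 0}
  tgt := {p | p ∈ HammockVAll l w \ HammockV i l w ∧ p.2 = (w : ℤ)}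

/-- The complementary edge: ē of e = {(x,y),(x+1,y±1)} is {(x+1,y),(x,y±1)}. -/
def complEdge : Sym2 (ℤ × ℤ) → Sym2 (ℤ × ℤ) :=
  Sym2.lift ⟨fun a b => s((a.1, b.2), (b.1, a.2)), fun _ _ => Sym2.eq_swap⟩

/-- The other kind: 2/1 = 2 and 2/2 = 1. -/
def otherKind (i : ℕ) : ℕ := if i = 1 then 2 else 1

/-- The edge set E^{(i)}_{l,w} as a finite set. -/
noncomputable def hammockEFinset (i l w : ℕ) : Finset (Sym2 (ℤ × ℤ)) :=
  ((Finset.Icc (0 : ℤ) l) ×ˢ (Finset.Icc (0 : ℤ) w)).sym2.filter (· ∈ HammockE i l w)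

/-- The reliability polynomial h^{(i)}_{l,w}(p) = Σ_P p^{|P|} (1-p)^{lw-|P|},
summing over all pathsets P of H^{(i)}_{l,w}. -/
noncomputable def hammockRel (i l w : ℕ) (p : ℝ) : ℝ :=
  ∑ P ∈ (hammockEFinset i l w).powerset.filter (fun P : Finset (Sym2 (ℤ × ℤ)) => (hammock i l w).IsPathset ↑P),
    p ^ P.card * (1 - p) ^ (l * w - P.card)

/-- Parity predicate in terms of a remainder. -/
lemma exists_parity_residue (i : ℕ) : ∃ k : ℤ, (k = 0 ∨ k = 1) ∧
    ∀ p : ℤ × ℤ, HammockPar i p ↔ (p.1 + p.2) % 2 = k := by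
  by_cases h : i = 1
  · exact ⟨0, Or.inl rfl, fun p => by simp [HammockPar, h, Int.even_iff]⟩
  · exact ⟨1, Or.inr rfl, fun p => by simp [HammockPar, h, Int.odd_iff]⟩

lemma mem_EAll (l w : ℕ) (a b : ℤ × ℤ) : s(a, b) ∈ HammockEAll l w ↔
    a ∈ HammockVAll l w ∧ b ∈ HammockVAll l w ∧ |a.1 - b.1| = 1 ∧ |a.2 - b.2| = 1 := by
  constructor
  · rintro ⟨c, d, h, hc, hd, h1, h2⟩
    rcases Sym2.eq_iff.1 h with ⟨rfl, rfl⟩ | ⟨rfl, rfl⟩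
    · exact ⟨hc, hd, h1, h2⟩
    · exact ⟨hd, hc, by rwa [abs_sub_comm], by rwa [abs_sub_comm]⟩
  · rintro ⟨hc, hd, h1, h2⟩
    exact ⟨a, b, rfl, hc, hd, h1, h2⟩

lemma mem_HE (i l w : ℕ) (a b : ℤ × ℤ) : s(a, b) ∈ HammockE i l w ↔
    s(a, b) ∈ HammockEAll l w ∧ HammockPar i a ∧ HammockPar i b := by
  constructor
  · rintro ⟨h, hp⟩
    exact ⟨h, hp a (Sym2.mem_mk_left a b), hp b (Sym2.mem_mk_right a b)⟩
  · rintro ⟨h, ha, hb⟩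
    refine ⟨h, fun p hp => ?_⟩
    rcases Sym2.mem_iff.1 hp with rfl | rfl
    · exact ha
    · exact hb

lemma abs_one_iff (x : ℤ) : |x| = 1 ↔ x = 1 ∨ x = -1 := by
  rw [abs_eq (by norm_num)]

lemma complEdge_mk (a b : ℤ × ℤ) :
    complEdge s(a, b) = s((a.1, b.2), (b.1, a.2)) := rfl

lemma complEdge_invol (e : Sym2 (ℤ × ℤ)) : complEdge (complEdge e) = e := by
  induction e using Sym2.ind with
  | _ a b => rfl

lemma complEdge_mem_dual (i l w : ℕ) {e : Sym2 (ℤ × ℤ)} (h : e ∈ HammockE i l w) :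
    complEdge e ∈ HammockEAll l w \ HammockE i l w := by
  induction e using Sym2.ind with
  | _ a b =>
    obtain ⟨k, hk, hp⟩ := exists_parity_residue i
    simp only [complEdge_mk, Set.mem_sdiff, mem_HE, mem_EAll, hp, HammockVAll, Set.mem_ofPred_eq,
      abs_one_iff] at h ⊢
    omega

lemma complEdge_mem_primal (i l w : ℕ) {e : Sym2 (ℤ × ℤ)}
    (h : e ∈ HammockEAll l w \ HammockE i l w) : complEdge e ∈ HammockE i l w := by
  induction e using Sym2.ind with
  | _ a b =>
    obtain ⟨k, hk, hp⟩ := exists_parity_residue i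
    simp only [complEdge_mk, Set.mem_sdiff, mem_HE, mem_EAll, hp, HammockVAll, Set.mem_ofPred_eq,
      abs_one_iff] at h ⊢
    omega

/-- One step along an edge of `P`. -/
def StepIn (P : Set (Sym2 (ℤ × ℤ))) (a b : ℤ × ℤ) : Prop := s(a, b) ∈ P

lemma chain_of_xEdges (P : Set (Sym2 (ℤ × ℤ))) (vs : List (ℤ × ℤ)) :
    (∀ e ∈ xEdges vs, e ∈ P) ↔ vs.IsChain (StepIn P) := by
  induction vs with
  | nil => simp [xEdges]
  | cons a t ih =>
    cases t with
    | nil => simp [xEdges]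
    | cons b t =>
      rw [List.isChain_cons_cons, ← ih]
      simp [xEdges, StepIn]

lemma xstep_of_mem (l w : ℕ) (a b : ℤ × ℤ) (h : s(a, b) ∈ HammockEAll l w) :
    b - a ∈ XStep := by
  rw [mem_EAll] at h
  obtain ⟨-, -, h1, h2⟩ := h
  rw [abs_one_iff] at h1 h2
  simp only [XStep, Set.mem_insert_iff, Set.mem_singleton_iff, Prod.ext_iff, Prod.fst_sub,
    Prod.snd_sub]
  omega

lemma exists_xpath (l w : ℕ) (P : Set (Sym2 (ℤ × ℤ))) (hP : P ⊆ HammockEAll l w)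
    (a b : ℤ × ℤ) (h : Relation.ReflTransGen (StepIn P) a b) :
    ∃ (vs : List (ℤ × ℤ)) (hv : vs ≠ []), IsXPath vs ∧ vs.head hv = a ∧ vs.getLast hv = b ∧
      ∀ e ∈ xEdges vs, e ∈ P := by
  let G : SimpleGraph (ℤ × ℤ) :=
    { Adj := StepIn P
      symm := ⟨fun a b h => by
        have : s(a, b) ∈ P := h
        rw [Sym2.eq_swap] at this
        exact this⟩
      loopless := ⟨fun a h => by
        have := (mem_EAll l w a a).1 (hP h)
        simp at this⟩ }
  have hr : G.Reachable a b := by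
    rw [SimpleGraph.reachable_iff_reflTransGen]
    exact h
  obtain ⟨p⟩ := hr
  let q := p.toPath
  have hc : q.1.support.IsChain (StepIn P) := q.1.isChain_adj_support
  refine ⟨q.1.support, q.1.support_ne_nil, ⟨q.2.support_nodup, ?_⟩, q.1.head_support,
    q.1.getLast_support, (chain_of_xEdges P _).2 hc⟩
  exact hc.imp fun a b h => xstep_of_mem l w a b (hP h)

lemma isPathset_iff (l w : ℕ) (N : HNetwork) (hN : N.edges ⊆ HammockEAll l w)
    (P : Set (Sym2 (ℤ × ℤ))) : N.IsPathset P ↔ P ⊆ N.edges ∧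
      ∃ a ∈ N.src, ∃ b ∈ N.tgt, Relation.ReflTransGen (StepIn P) a b := by
  constructor
  · rintro ⟨hP, vs, hv, -, hs, ht, he⟩
    refine ⟨hP, _, hs, _, ht, ?_⟩
    exact List.relationReflTransGen_of_exists_isChain vs ((chain_of_xEdges P _).1 he) hv
  · rintro ⟨hP, a, ha, b, hb, h⟩
    obtain ⟨vs, hv, h1, h2, h3, h4⟩ := exists_xpath l w P (hP.trans hN) a b h
    exact ⟨hP, vs, hv, h1, h2 ▸ ha, h3 ▸ hb, h4⟩

/-- Indicator of the half-line to the left of `u` containing `v`. -/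
def halfLine (v u : ℤ × ℤ) : ℤ := if v.2 = u.2 ∧ v.1 < u.1 then 1 else 0

/-- Signed count of a step `v → v'` hitting the ray to the left of `u` (slightly lifted). -/
def rayHit (v v' u : ℤ × ℤ) : ℤ :=
  if min v.2 v'.2 = u.2 ∧ min v.1 v'.1 < u.1 then v'.2 - v.2 else 0

lemma not_cross (v1 v2 v1' v2' u1 u2 u1' : ℤ) (hx : v1 - v1' = 1 ∨ v1 - v1' = -1)
    (hy : v2 - v2' = 1 ∨ v2 - v2' = -1) (hx' : u1 - u1' = 1 ∨ u1 - u1' = -1)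
    (hpar : (v1 + v2 + u1 + u2) % 2 = 1)
    (h1 : ¬ ((v1 = u1 ∧ v2 = u2 + 1) ∧ v1' = u1' ∧ v2' = u2))
    (h2 : ¬ ((v1' = u1 ∧ v2' = u2 + 1) ∧ v1 = u1' ∧ v2 = u2)) :
    ¬ (min v1 v1' = min u1 u1' ∧ min v2 v2' = u2) := by
  rintro ⟨e1, e2⟩
  rcases hx with hx | hx <;> rcases hy with hy | hy <;> rcases hx' with hx' | hx' <;> omega

lemma hammock_edges_sub (i l w : ℕ) : (hammock i l w).edges ⊆ HammockEAll l w := by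
  intro e h
  exact h.1

lemma hammockDual_edges_sub (i l w : ℕ) : (hammockDual i l w).edges ⊆ HammockEAll l w := by
  intro e h
  exact h.1

lemma ray_step (v1 v2 v1' v2' u1 u2 u1' : ℤ) (hx : v1 - v1' = 1 ∨ v1 - v1' = -1)
    (hy : v2 - v2' = 1 ∨ v2 - v2' = -1) (hx' : u1 - u1' = 1 ∨ u1 - u1' = -1)
    (hpar : (v1 + v2 + u1 + u2) % 2 = 1)
    (hc : ¬ (min v1 v1' = min u1 u1' ∧ min v2 v2' = u2)) :
    rayHit (v1, v2) (v1', v2') (u1, u2) - rayHit (v1, v2) (v1', v2') (u1', u2 + 1)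
      = halfLine (v1', v2') (u1', u2 + 1) - halfLine (v1, v2) (u1', u2 + 1) := by
  simp only [rayHit, halfLine]
  obtain ⟨m, hm⟩ : ∃ m, m = min v1 v1' := ⟨_, rfl⟩
  obtain ⟨n, hn⟩ : ∃ n, n = min v2 v2' := ⟨_, rfl⟩
  rw [← hm, ← hn] at hc ⊢
  by_cases h0 : n = u2
  · rcases hx with hx | hx <;> rcases hy with hy | hy <;> rcases hx' with hx' | hx' <;>
      split_ifs <;> omega
  by_cases h1 : n = u2 + 1
  · rcases hx with hx | hx <;> rcases hy with hy | hy <;> split_ifs <;> omega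
  · rw [if_neg (by omega), if_neg (by omega), if_neg (by omega), if_neg (by omega)]

set_option maxHeartbeats 1000000 in
lemma ray_count (i l w : ℕ) (Q : Set (Sym2 (ℤ × ℤ)))
    (hQ : Q ⊆ HammockEAll l w \ HammockE i l w) (a b : ℤ × ℤ)
    (h : Relation.ReflTransGen (StepIn Q) a b) :
    ∃ C : ℤ × ℤ → ℤ,
      (∀ u u' : ℤ × ℤ, s(u, u') ∈ HammockE i l w → u'.2 = u.2 + 1 → complEdge s(u, u') ∉ Q →
        C u - C u' = halfLine b u' - halfLine a u') ∧
      (∀ u : ℤ × ℤ, u.1 = 0 → C u = 0) ∧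
      (∀ u : ℤ × ℤ, u.1 = l → C u = (if a.2 ≤ u.2 then 1 else 0) - (if b.2 ≤ u.2 then 1 else 0)) := by
  induction h with
  | refl => exact ⟨fun _ => 0, by simp, by simp, by simp⟩
  | @tail v v' _ hs ih =>
    obtain ⟨C, h1, h2, h3⟩ := ih
    obtain ⟨k, hk, hp⟩ := exists_parity_residue i
    have hvv := hQ hs
    simp only [Set.mem_sdiff, mem_HE, mem_EAll, hp, HammockVAll, Set.mem_ofPred_eq,
      abs_one_iff] at hvv
    refine ⟨fun u => C u + rayHit v v' u, ?_, ?_, ?_⟩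
    · intro u u' hu huu hc
      have e1 := h1 u u' hu huu hc
      have hne : ¬ (v = (u.1, u'.2) ∧ v' = (u'.1, u.2)) := by
        rintro ⟨rfl, rfl⟩
        exact hc hs
      have hne' : ¬ (v' = (u.1, u'.2) ∧ v = (u'.1, u.2)) := by
        rintro ⟨rfl, rfl⟩
        apply hc
        rw [complEdge_mk, Sym2.eq_swap]
        exact hs
      simp only [mem_HE, mem_EAll, hp, HammockVAll, Set.mem_ofPred_eq, abs_one_iff] at hu
      obtain ⟨v1, v2⟩ := v
      obtain ⟨v1', v2'⟩ := v'
      obtain ⟨u1, u2⟩ := u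
      obtain ⟨u1', u2'⟩ := u'
      simp only [Prod.mk.injEq] at *
      have key : rayHit (v1, v2) (v1', v2') (u1, u2) - rayHit (v1, v2) (v1', v2') (u1', u2')
          = halfLine (v1', v2') (u1', u2') - halfLine (v1, v2) (u1', u2') := by
        obtain ⟨⟨hA, hB, hx, hy⟩, hpar⟩ := hvv
        obtain ⟨⟨hC, hD, hx', hy'⟩, hpar'⟩ := hu
        subst huu
        have hvk : ¬ (v1 + v2) % 2 = k := by
          intro h
          refine hpar ⟨⟨hA, hB, hx, hy⟩, h, ?_⟩
          clear * - h hx hy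
          omega
        have hpp : (v1 + v2 + u1 + u2) % 2 = 1 := by
          have := hpar'.1
          clear * - this hvk hk
          omega
        exact ray_step v1 v2 v1' v2' u1 u2 u1' hx hy hx' hpp
          (not_cross v1 v2 v1' v2' u1 u2 u1' hx hy hx' hpp hne hne')
      linarith
    · intro u hu
      simp only [h2 u hu, rayHit, hu]
      rw [if_neg]
      · simp
      · omega
    · intro u hu
      simp only [h3 u hu, rayHit, hu]
      split_ifs <;> omega

lemma no_both (i l w : ℕ) (hw : 0 < w) (Q : Set (Sym2 (ℤ × ℤ)))
    (hQ : (hammockDual i l w).IsPathset Q) :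
    ¬ (hammock i l w).IsPathset (HammockE i l w \ complEdge '' Q) := by
  intro hP
  rw [isPathset_iff l w _ (hammock_edges_sub i l w)] at hP
  rw [isPathset_iff l w _ (hammockDual_edges_sub i l w)] at hQ
  obtain ⟨hQE, a, ha, b, hb, hab⟩ := hQ
  obtain ⟨-, c, hc, d, hd, hcd⟩ := hP
  obtain ⟨C, h1, h2, h3⟩ := ray_count i l w Q hQE a b hab
  simp only [hammockDual, hammock, HammockV, HammockVAll, Set.mem_sdiff, Set.mem_ofPred_eq] at ha hb hc hd
  have step : ∀ u u' : ℤ × ℤ, s(u, u') ∈ HammockE i l w \ complEdge '' Q → u'.2 = u.2 + 1 →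
      C u + halfLine b u = C u' + halfLine b u' := by
    intro u u' h hu
    have hn : complEdge s(u, u') ∉ Q := fun hm => h.2 ⟨_, hm, complEdge_invol _⟩
    have e := h1 u u' h.1 hu hn
    have hE := h.1
    simp only [mem_HE, mem_EAll, HammockVAll, Set.mem_ofPred_eq] at hE
    have e2 : halfLine a u' = 0 := by
      rw [halfLine, if_neg]; omega
    have e3 : halfLine b u = 0 := by
      rw [halfLine, if_neg]; omega
    linarith
  have const : C c + halfLine b c = C d + halfLine b d := by
    clear hc hd
    induction hcd with
    | refl => rfl
    | @tail u u' _ hs ih =>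
      rw [ih]
      have hE := hs.1
      simp only [mem_HE, mem_EAll, abs_one_iff] at hE
      rcases hE.1.2.2.2 with h | h
      · symm
        apply step u' u _ (by omega)
        rw [Sym2.eq_swap]
        exact hs
      · exact step u u' hs (by omega)
  have hc0 : C c + halfLine b c = 0 := by
    rw [h2 c hc.2, halfLine, if_neg]
    · simp
    · omega
  have hd1 : C d + halfLine b d = 1 := by
    have hne : ¬ (b.1 = d.1 ∧ b.2 = d.2) := by
      rintro ⟨x, y⟩
      have : b = d := Prod.ext x y
      subst this
      exact hb.1.2 hd.1
    rw [h3 d hd.2]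
    simp only [halfLine]
    split_ifs <;> omega
  omega

lemma sum_telescope (n : ℕ) (T : ℕ → ZMod 2) :
    ∑ x ∈ Finset.range n, (T x + T (x + 1)) = T 0 + T n := by
  induction n with
  | zero => simp [CharTwo.add_self_eq_zero]
  | succ n ih =>
    rw [Finset.sum_range_succ, ih]
    have := CharTwo.add_self_eq_zero (T n)
    linear_combination this

/-- Hex-type lemma. -/
lemma hex_cell (l w : ℕ) (p : ℕ → ℕ → Prop) (F : ℕ → ℕ → ZMod 2)
    (px : ∀ x y, p (x + 1) y ↔ ¬ p x y) (py : ∀ x y, p x (y + 1) ↔ ¬ p x y)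
    (hL : ∀ y ≤ w, p 0 y → F 0 y = 1) (hR : ∀ y ≤ w, p l y → F l y = 0)
    (hB : ∀ x ≤ l, ¬ p x 0 → F x 0 = 1) (hT : ∀ x ≤ l, ¬ p x w → F x w = 0) :
    ∃ x < l, ∃ y < w, F x y ≠ F (x + 1) (y + 1) ∧ F (x + 1) y ≠ F x (y + 1) := by
  by_contra hcon
  push Not at hcon
  have hz : ∑ x ∈ Finset.range l, ∑ y ∈ Finset.range w,
      (F x y + F (x + 1) (y + 1)) * (F (x + 1) y + F x (y + 1)) = 0 := by
    refine Finset.sum_eq_zero fun x hx => Finset.sum_eq_zero fun y hy => ?_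
    by_cases h : F x y = F (x + 1) (y + 1)
    · rw [h, CharTwo.add_self_eq_zero, zero_mul]
    · rw [hcon x (Finset.mem_range.1 hx) y (Finset.mem_range.1 hy) h, CharTwo.add_self_eq_zero,
        mul_zero]
  have hs : ∑ x ∈ Finset.range l, ∑ y ∈ Finset.range w,
      (F x y + F (x + 1) (y + 1)) * (F (x + 1) y + F x (y + 1)) =
      (∑ x ∈ Finset.range l, (F x 0 * F (x + 1) 0 + F x w * F (x + 1) w)) +
      ∑ y ∈ Finset.range w, (F 0 y * F 0 (y + 1) + F l y * F l (y + 1)) := by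
    have e1 : ∀ x y, (F x y + F (x + 1) (y + 1)) * (F (x + 1) y + F x (y + 1)) =
        (F x y * F (x + 1) y + F x (y + 1) * F (x + 1) (y + 1)) +
        (F x y * F x (y + 1) + F (x + 1) y * F (x + 1) (y + 1)) := fun x y => by ring
    have e2 : ∀ x, ∑ y ∈ Finset.range w,
        (F x y + F (x + 1) (y + 1)) * (F (x + 1) y + F x (y + 1)) =
        ∑ y ∈ Finset.range w, (F x y * F (x + 1) y + F x (y + 1) * F (x + 1) (y + 1)) +
        ∑ y ∈ Finset.range w, (F x y * F x (y + 1) + F (x + 1) y * F (x + 1) (y + 1)) := by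
      intro x
      rw [← Finset.sum_add_distrib]
      exact Finset.sum_congr rfl fun y _ => e1 x y
    rw [Finset.sum_congr rfl fun x _ => e2 x, Finset.sum_add_distrib]
    congr 1
    · exact Finset.sum_congr rfl fun x _ => sum_telescope w (fun y => F x y * F (x + 1) y)
    · rw [Finset.sum_comm]
      exact Finset.sum_congr rfl fun y _ => sum_telescope l (fun x => F x y * F x (y + 1))
  have hbot : ∀ x ∈ Finset.range l, F x 0 * F (x + 1) 0 + F x w * F (x + 1) w =
      (if p x 0 then F x 0 else 0) + (if p (x + 1) 0 then F (x + 1) 0 else 0) := by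
    intro x hx
    have hx := Finset.mem_range.1 hx
    have t : F x w * F (x + 1) w = 0 := by
      by_cases h : p x w
      · rw [hT (x + 1) hx (by rw [px]; simpa using h), mul_zero]
      · rw [hT x hx.le h, zero_mul]
    rw [t]
    by_cases h : p x 0
    · have h' : ¬ p (x + 1) 0 := by rw [px]; simpa using h
      simp [h, h', hB (x + 1) hx h']
    · have h' : p (x + 1) 0 := by rwa [px]
      simp [h, h', hB x hx.le h]
  have hleft : ∀ y ∈ Finset.range w, F 0 y * F 0 (y + 1) + F l y * F l (y + 1) =
      (if p 0 y then 0 else F 0 y) + (if p 0 (y + 1) then 0 else F 0 (y + 1)) := by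
    intro y hy
    have hy := Finset.mem_range.1 hy
    have t : F l y * F l (y + 1) = 0 := by
      by_cases h : p l y
      · rw [hR y hy.le h, zero_mul]
      · rw [hR (y + 1) hy (by rwa [py]), mul_zero]
    rw [t]
    by_cases h : p 0 y
    · have h' : ¬ p 0 (y + 1) := by rw [py]; simpa using h
      simp [h, h', hL y hy.le h]
    · have h' : p 0 (y + 1) := by rwa [py]
      simp [h, h', hL (y + 1) hy h']
  rw [Finset.sum_congr rfl hbot, Finset.sum_congr rfl hleft,
    sum_telescope l (fun x => if p x 0 then F x 0 else 0),
    sum_telescope w (fun y => if p 0 y then 0 else F 0 y), hz] at hs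
  have t1 : (if p l 0 then F l 0 else 0) = 0 := by
    split_ifs with h
    · exact hR 0 (Nat.zero_le _) h
    · rfl
  have t2 : (if p 0 w then 0 else F 0 w) = 0 := by
    split_ifs with h
    · rfl
    · exact hT 0 (Nat.zero_le _) h
  rw [t1, t2] at hs
  by_cases h : p 0 0
  · simp [h, hL 0 (Nat.zero_le _) h] at hs
  · simp [h, hB 0 (Nat.zero_le _) h] at hs

/-- `v` is reachable inside `P` from the set `A`. -/
def ReachFrom (A : Set (ℤ × ℤ)) (P : Set (Sym2 (ℤ × ℤ))) (v : ℤ × ℤ) : Prop :=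
  ∃ a ∈ A, Relation.ReflTransGen (StepIn P) a v

lemma reach_iff (A : Set (ℤ × ℤ)) (P : Set (Sym2 (ℤ × ℤ))) (u v : ℤ × ℤ) (h : s(u, v) ∈ P) :
    ReachFrom A P u ↔ ReachFrom A P v := by
  constructor
  · rintro ⟨a, ha, hr⟩
    exact ⟨a, ha, hr.tail h⟩
  · rintro ⟨a, ha, hr⟩
    refine ⟨a, ha, hr.tail ?_⟩
    rw [Sym2.eq_swap] at h
    exact h

lemma some_one (i l w : ℕ) (S : Set (Sym2 (ℤ × ℤ)))
    (hS : S ⊆ HammockE i l w)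
    (hcut : ¬ (hammock i l w).IsPathset (HammockE i l w \ S)) :
    (hammockDual i l w).IsPathset (complEdge '' S) := by
  have hsub : complEdge '' S ⊆ HammockEAll l w \ HammockE i l w := by
    rintro _ ⟨e, he, rfl⟩
    exact complEdge_mem_dual i l w (hS he)
  by_contra hd
  rw [isPathset_iff l w _ (hammock_edges_sub i l w)] at hcut
  rw [isPathset_iff l w _ (hammockDual_edges_sub i l w)] at hd
  have hcut : ∀ v ∈ (hammock i l w).tgt,
      ¬ ReachFrom (hammock i l w).src (HammockE i l w \ S) v := by
    rintro v hv ⟨a, ha, hr⟩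
    exact hcut ⟨fun e h => h.1, a, ha, v, hv, hr⟩
  have hd : ∀ v ∈ (hammockDual i l w).tgt,
      ¬ ReachFrom (hammockDual i l w).src (complEdge '' S) v := by
    rintro v hv ⟨a, ha, hr⟩
    exact hd ⟨hsub, a, ha, v, hv, hr⟩
  obtain ⟨k, hk, hp⟩ := exists_parity_residue i
  have edge : ∀ u u' : ℤ × ℤ, s(u, u') ∈ HammockE i l w →
      (ReachFrom (hammock i l w).src (HammockE i l w \ S) u ↔
        ReachFrom (hammock i l w).src (HammockE i l w \ S) u') ∨
      (ReachFrom (hammockDual i l w).src (complEdge '' S) (u.1, u'.2) ↔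
        ReachFrom (hammockDual i l w).src (complEdge '' S) (u'.1, u.2)) := by
    intro u u' h
    by_cases hm : s(u, u') ∈ S
    · right
      exact reach_iff _ _ _ _ ⟨_, hm, rfl⟩
    · left
      exact reach_iff _ _ _ _ ⟨h, hm⟩
  generalize hRe : ReachFrom (hammock i l w).src (HammockE i l w \ S) = R at *
  generalize hKe : ReachFrom (hammockDual i l w).src (complEdge '' S) = K at *
  have hR0 : ∀ v ∈ (hammock i l w).src, R v := fun v hv => hRe ▸ ⟨v, hv, .refl⟩
  have hK0 : ∀ v ∈ (hammockDual i l w).src, K v := fun v hv => hKe ▸ ⟨v, hv, .refl⟩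
  simp only [hammockDual, hammock, HammockV, HammockVAll, Set.mem_sdiff, Set.mem_ofPred_eq, hp]
    at hR0 hK0 hcut hd
  obtain ⟨x, hx, y, hy, h1, h2⟩ := hex_cell l w (fun x y => ((x : ℤ) + y) % 2 = k)
    (fun x y => if (if ((x : ℤ) + y) % 2 = k then R (x, y) else K (x, y)) then 1 else 0)
    (by intro x y; push_cast; omega) (by intro x y; push_cast; omega)
    (by
      intro y hy h
      have := hR0 (0, y) (by simp at h ⊢; omega)
      simp at h
      simp [h, this])
    (by
      intro y hy h
      have := hcut (l, y) (by simp at h ⊢; omega)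
      simp [h, this])
    (by
      intro x hx h
      have := hK0 (x, 0) (by simp at h ⊢; omega)
      simp at h
      simp [h, this])
    (by
      intro x hx h
      have := hd (x, w) (by simp at h ⊢; omega)
      simp [h, this])
  push_cast at h1 h2
  by_cases hpar : ((x : ℤ) + y) % 2 = k
  · have p1 : ((x : ℤ) + 1 + (y + 1)) % 2 = k := by omega
    have p2 : ¬ ((x : ℤ) + 1 + y) % 2 = k := by omega
    have p3 : ¬ ((x : ℤ) + (y + 1)) % 2 = k := by omega
    rcases edge (x, y) (x + 1, y + 1) (by
      simp only [mem_HE, mem_EAll, hp, HammockVAll, Set.mem_ofPred_eq, abs_one_iff]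
      omega) with h | h
    · exact h1 (by simp only [hpar, p1, if_true, h])
    · exact h2 (by simp only [p2, p3, if_false, h])
  · have p1 : ¬ ((x : ℤ) + 1 + (y + 1)) % 2 = k := by omega
    have p2 : ((x : ℤ) + 1 + y) % 2 = k := by omega
    have p3 : ((x : ℤ) + (y + 1)) % 2 = k := by omega
    rcases edge (x, y + 1) (x + 1, y) (by
      simp only [mem_HE, mem_EAll, hp, HammockVAll, Set.mem_ofPred_eq, abs_one_iff]
      omega) with h | h
    · exact h2 (by simp only [p2, p3, if_true, h])
    · exact h1 (by simp only [hpar, p1, if_false, h])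

/-- If Σ ⊆ E^{(i)}_{l,w} is a mincut of the hammock network H^{(i)}_{l,w},
then the set of complementary edges Σ̄ is a minpath of the dual network H̄^{(i)}_{l,w}. -/
theorem mincut_compl_isMinpath_dual (l w : ℕ) (hl : 0 < l) (hw : 0 < w)
    (i : ℕ) (hi : i = 1 ∨ i = 2) (S : Set (Sym2 (ℤ × ℤ)))
    (hSE : S ⊆ HammockE i l w) (hS : (hammock i l w).IsMincut S) :
    (hammockDual i l w).IsMinpath (complEdge '' S) := by
  refine ⟨some_one i l w S hSE hS.1.2, fun Q hQ hQp => ?_⟩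
  have hsub : complEdge '' Q ⊆ S := by
    rintro _ ⟨e, he, rfl⟩
    obtain ⟨f, hf, rfl⟩ := hQ.1 he
    rwa [complEdge_invol]
  refine hS.2 (complEdge '' Q) ⟨hsub, fun hle => hQ.2 ?_⟩
    ⟨hsub.trans hSE, no_both i l w hw Q hQp⟩
  rintro _ ⟨e, he, rfl⟩
  obtain ⟨f, hf, rfl⟩ := hle he
  rwa [complEdge_invol]
end

section
/- Let l, w be positive integers and i ∈ {1,2}. A subset Σ ⊆ E^{(i)}_{l,w} is a pathset of the hammock network H^{(i)}_{l,w} if and only if the set of complementary edges Σ̄ = {ē : e ∈ Σ} is a cutset of the dual network H̄^{(i)}_{l,w}. -/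
open scoped Classical

namespace HamAux

/-- Box membership with parity `k`. -/
def Vx (k : ℤ) (l w : ℕ) (p : ℤ × ℤ) : Prop :=
  0 ≤ p.1 ∧ p.1 ≤ (l : ℤ) ∧ 0 ≤ p.2 ∧ p.2 ≤ (w : ℤ) ∧ (p.1 + p.2) % 2 = k

/-- Diagonal neighbours. -/
def Dg (a b : ℤ × ℤ) : Prop :=
  (b.1 = a.1 + 1 ∨ b.1 = a.1 - 1) ∧ (b.2 = a.2 + 1 ∨ b.2 = a.2 - 1)

lemma dg_iff (a b : ℤ × ℤ) : Dg a b ↔ |a.1 - b.1| = 1 ∧ |a.2 - b.2| = 1 := by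
  unfold Dg
  rw [abs_eq (by norm_num), abs_eq (by norm_num)]
  omega

lemma dg_xstep {a b : ℤ × ℤ} (h : Dg a b) : b - a ∈ XStep := by
  obtain ⟨a1, a2⟩ := a
  obtain ⟨b1, b2⟩ := b
  simp only [Dg] at h
  simp only [XStep, Set.mem_insert_iff, Set.mem_singleton_iff, Prod.mk_sub_mk, Prod.mk.injEq]
  omega

lemma mem_EAll {l w : ℕ} {a b : ℤ × ℤ} : s(a, b) ∈ HammockEAll l w ↔
    a ∈ HammockVAll l w ∧ b ∈ HammockVAll l w ∧ Dg a b := by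
  constructor
  · rintro ⟨c, d, h, hc, hd, h1, h2⟩
    have hcd : Dg c d := (dg_iff _ _).2 ⟨h1, h2⟩
    rcases Sym2.eq_iff.1 h with ⟨rfl, rfl⟩ | ⟨rfl, rfl⟩
    · exact ⟨hc, hd, hcd⟩
    · refine ⟨hd, hc, ?_⟩
      unfold Dg at *
      omega
  · rintro ⟨ha, hb, h⟩
    exact ⟨a, b, rfl, ha, hb, (dg_iff _ _).1 h⟩

lemma par_iff {i : ℕ} (hi : i = 1 ∨ i = 2) (p : ℤ × ℤ) :
    HammockPar i p ↔ (p.1 + p.2) % 2 = (i : ℤ) - 1 := by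
  rcases hi with rfl | rfl
  · simp [HammockPar, Int.even_iff]
  · simp [HammockPar, Int.odd_iff]

lemma mem_xEdges {vs : List (ℤ × ℤ)} {r : ℤ × ℤ → ℤ × ℤ → Prop} (h : vs.IsChain r)
    {e : Sym2 (ℤ × ℤ)} (he : e ∈ xEdges vs) : ∃ a b, e = s(a, b) ∧ r a b := by
  induction vs with
  | nil => simp [xEdges] at he
  | cons a t ih =>
    cases t with
    | nil => simp [xEdges] at he
    | cons b t =>
      rw [List.isChain_cons_cons] at h
      simp only [xEdges, List.tail_cons, List.zip_cons_cons, List.map_cons, List.mem_cons] at he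
      rcases he with rfl | he
      · exact ⟨a, b, rfl, h.1⟩
      · exact ih h.2 (by simpa [xEdges] using he)

lemma rtg_of_xEdges {P : Set (Sym2 (ℤ × ℤ))} : ∀ (vs : List (ℤ × ℤ)) (h : vs ≠ []),
    (∀ e ∈ xEdges vs, e ∈ P) →
    Relation.ReflTransGen (fun a b => s(a, b) ∈ P) (vs.head h) (vs.getLast h)
  | [], h, _ => absurd rfl h
  | [a], _, _ => Relation.ReflTransGen.refl
  | a :: b :: t, h, he => by
    have h1 := rtg_of_xEdges (P := P) (b :: t) (by simp) (fun e hh => he e (by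
      simp only [xEdges, List.tail_cons, List.zip_cons_cons, List.map_cons, List.mem_cons]
      right
      simpa [xEdges] using hh))
    have h2 : s(a, b) ∈ P := he _ (by simp [xEdges])
    simp only [List.head_cons, List.getLast_cons_cons] at h1 ⊢
    exact Relation.ReflTransGen.head h2 h1

lemma exists_list {P : Set (Sym2 (ℤ × ℤ))} (hP : ∀ a b, s(a, b) ∈ P → Dg a b) {a b : ℤ × ℤ}
    (h : Relation.ReflTransGen (fun a b => s(a, b) ∈ P) a b) :
    ∃ (vs : List (ℤ × ℤ)) (h : vs ≠ []),
      IsXPath vs ∧ vs.head h = a ∧ vs.getLast h = b ∧ ∀ e ∈ xEdges vs, e ∈ P := by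
  let G : SimpleGraph (ℤ × ℤ) :=
    { Adj := fun a b => s(a, b) ∈ P
      symm := ⟨fun a b h => by rwa [Sym2.eq_swap]⟩
      loopless := ⟨fun a h => by
        have := hP a a h
        unfold Dg at this
        omega⟩ }
  have hr : G.Reachable a b := (SimpleGraph.reachable_iff_reflTransGen a b).2 h
  obtain ⟨p, hp⟩ := hr.exists_isPath
  have hc : p.support.IsChain G.Adj := p.isChain_adj_support
  refine ⟨p.support, p.support_ne_nil, ⟨hp.support_nodup, ?_⟩, p.head_support, p.getLast_support, ?_⟩
  · exact hc.imp (fun a b h => dg_xstep (hP a b h))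
  · intro e he
    obtain ⟨a, b, rfl, h⟩ := mem_xEdges hc he
    exact h

lemma isPathset_iff (N : HNetwork) (l w : ℕ) (hN : N.edges ⊆ HammockEAll l w)
    (P : Set (Sym2 (ℤ × ℤ))) (hP : P ⊆ N.edges) :
    N.IsPathset P ↔ ∃ a ∈ N.src, ∃ b ∈ N.tgt,
      Relation.ReflTransGen (fun a b => s(a, b) ∈ P) a b := by
  constructor
  · rintro ⟨_, vs, h, _, h1, h2, h3⟩
    exact ⟨_, h1, _, h2, rtg_of_xEdges vs h h3⟩
  · rintro ⟨a, ha, b, hb, h⟩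
    obtain ⟨vs, hne, hx, rfl, rfl, he⟩ :=
      exists_list (fun a b hab => (mem_EAll.1 (hN (hP hab))).2.2) h
    exact ⟨hP, vs, hne, hx, ha, hb, he⟩

/-- Crossing indicator of the step `a b` with the downward ray at `v`. -/
noncomputable def cr (a b v : ℤ × ℤ) : ZMod 2 :=
  (if a.1 = v.1 ∧ b.1 = v.1 + 1 ∧ a.2 < v.2 then 1 else 0) +
  (if b.1 = v.1 ∧ a.1 = v.1 + 1 ∧ b.2 < v.2 then 1 else 0)

/-- Potential. -/
noncomputable def ph (v p : ℤ × ℤ) : ZMod 2 := if p.1 = v.1 ∧ p.2 < v.2 then 1 else 0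

set_option maxHeartbeats 2000000 in
lemma cr_step {k : ℤ} {a b v v' : ℤ × ℤ} (hab : Dg a b) (hv : Dg v v') (hx : v'.1 = v.1 + 1)
    (ha : (a.1 + a.2) % 2 = k) (hk : (v.1 + v.2) % 2 ≠ k)
    (h1 : ¬ (a = (v.1, v'.2) ∧ b = (v'.1, v.2))) (h2 : ¬ (b = (v.1, v'.2) ∧ a = (v'.1, v.2))) :
    cr a b v + cr a b v' = ph v' a + ph v' b := by
  obtain ⟨a1, a2⟩ := a
  obtain ⟨b1, b2⟩ := b
  obtain ⟨x, y⟩ := v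
  obtain ⟨x', y'⟩ := v'
  simp only [Dg, Prod.mk.injEq, cr, ph] at *
  subst hx
  have e2 : (1 : ZMod 2) + 1 = 0 := by decide
  split_ifs <;> first | (exfalso; omega) | simp [e2]

lemma cr_top {k : ℤ} {w : ℕ} {a b v : ℤ × ℤ} (hab : Dg a b) (hvw : v.2 = w)
    (ha : (a.1 + a.2) % 2 = k) (hb : (b.1 + b.2) % 2 = k) (hk : (v.1 + v.2) % 2 ≠ k)
    (haw : a.2 ≤ w) (hbw : b.2 ≤ w) :
    cr a b v = (if a.1 ≤ v.1 then 1 else 0) + (if b.1 ≤ v.1 then 1 else 0) := by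
  obtain ⟨a1, a2⟩ := a
  obtain ⟨b1, b2⟩ := b
  obtain ⟨x, y⟩ := v
  simp only [Dg, cr] at *
  have e2 : (1 : ZMod 2) + 1 = 0 := by decide
  split_ifs <;> first | (exfalso; omega) | simp [e2]

lemma z2 (a : ZMod 2) : a + a = 0 := CharTwo.add_self_eq_zero a

lemma exists_c {k : ℤ} {l w : ℕ} {A : ℤ × ℤ → ℤ × ℤ → Prop}
    (hAs : ∀ a b, A a b → A b a)
    (hA : ∀ a b, A a b → Vx k l w a ∧ Vx k l w b ∧ Dg a b) {a b : ℤ × ℤ}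
    (h : Relation.ReflTransGen A a b) :
    ∃ c : ℤ × ℤ → ZMod 2,
      (∀ v v', Dg v v' → v'.1 = v.1 + 1 → (v.1 + v.2) % 2 ≠ k →
        ¬ A (v.1, v'.2) (v'.1, v.2) → c v + c v' = ph v' a + ph v' b) ∧
      (∀ v : ℤ × ℤ, v.2 = 0 → c v = 0) ∧
      (∀ v : ℤ × ℤ, v.2 = w → (v.1 + v.2) % 2 ≠ k →
        c v = (if a.1 ≤ v.1 then 1 else 0) + (if b.1 ≤ v.1 then 1 else 0)) := by
  induction h with
  | refl => exact ⟨fun _ => 0, fun v v' _ _ _ _ => by simp [z2], fun _ _ => rfl,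
      fun v _ _ => by simp [z2]⟩
  | @tail b d _ hbd ih =>
    obtain ⟨c, h1, h2, h3⟩ := ih
    obtain ⟨hb, hd, hdg⟩ := hA _ _ hbd
    refine ⟨fun v => c v + cr b d v, ?_, ?_, ?_⟩
    · intro v v' hv hx hk hn
      have e1 := h1 v v' hv hx hk hn
      have e2 := cr_step hdg hv hx hb.2.2.2.2 hk
        (by rintro ⟨rfl, rfl⟩; exact hn hbd) (by rintro ⟨rfl, rfl⟩; exact hn (hAs _ _ hbd))
      have e3 := z2 (ph v' b)
      linear_combination e1 + e2 + e3
    · intro v hv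
      have := h2 v hv
      have hb' := hb.2.2.1
      have hd' := hd.2.2.1
      simp only [this, cr]
      rw [if_neg (by omega), if_neg (by omega)]
      simp
    · intro v hv hk
      have e1 := h3 v hv hk
      have e2 := cr_top hdg hv hb.2.2.2.2 hd.2.2.2.2 hk hb.2.2.2.1 hd.2.2.2.1
      have e3 := z2 (if b.1 ≤ v.1 then 1 else 0)
      linear_combination e1 + e2 + e3

lemma not_both {k : ℤ} {l w : ℕ} {A B : ℤ × ℤ → ℤ × ℤ → Prop}
    (hAs : ∀ a b, A a b → A b a)
    (hA : ∀ a b, A a b → Vx k l w a ∧ Vx k l w b ∧ Dg a b)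
    (hB : ∀ a b, B a b → Vx (1 - k) l w a ∧ Vx (1 - k) l w b ∧ Dg a b ∧
      ¬ A (a.1, b.2) (b.1, a.2))
    {a b : ℤ × ℤ} (ha0 : a.1 = 0) (hbv : Vx k l w b) (hbl : b.1 = l)
    (h : Relation.ReflTransGen A a b)
    {c d : ℤ × ℤ} (hc0 : c.2 = 0) (hdv : Vx (1 - k) l w d) (hdw : d.2 = w)
    (h' : Relation.ReflTransGen B c d) : False := by
  obtain ⟨f, h1, h2, h3⟩ := exists_c hAs hA h
  let H : ℤ × ℤ → ZMod 2 := fun v => f v + ph v b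
  have stepR : ∀ v v', Vx (1 - k) l w v → Vx (1 - k) l w v' → Dg v v' → v'.1 = v.1 + 1 →
      ¬ A (v.1, v'.2) (v'.1, v.2) → H v = H v' := by
    intro v v' hv hv' hd hx hn
    have e := h1 v v' hd hx (by unfold Vx at hv; omega) hn
    have p1 : ph v' a = 0 := if_neg (by unfold Vx at *; omega)
    have p2 : ph v b = 0 := if_neg (by unfold Vx at *; omega)
    simp only [H, p2]
    rw [p1] at e
    have := z2 (f v')
    linear_combination e - this
  have step : ∀ v v', B v v' → H v = H v' := by
    intro v v' hb
    obtain ⟨hv, hv', hd, hn⟩ := hB _ _ hb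
    rcases hd.1 with hx | hx
    · exact stepR v v' hv hv' hd hx hn
    · refine (stepR v' v hv' hv ?_ (by omega) (fun hh => hn (hAs _ _ hh))).symm
      unfold Dg at *
      omega
  have hcd : H c = H d := by
    clear hdv hdw
    induction h' with
    | refl => rfl
    | tail _ hbd ih => exact ih.trans (step _ _ hbd)
  have hc : H c = 0 := by
    have p : ph c b = 0 := if_neg (by unfold Vx at *; omega)
    simp [H, h2 c hc0, p]
  have hd : H d = 1 := by
    simp only [H, h3 d hdw (by unfold Vx at hdv; omega), ph]
    unfold Vx at *
    rw [if_pos (by omega)]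
    by_cases hdl : d.1 = l
    · rw [if_pos (by omega), if_pos (by omega)]
      decide
    · rw [if_neg (by omega), if_neg (by omega)]
      decide
  rw [hc, hd] at hcd
  exact absurd hcd (by decide)

lemma tele (f : ℕ → ZMod 2) (n : ℕ) : ∑ i ∈ Finset.range n, (f i + f (i + 1)) = f 0 + f n := by
  induction n with
  | zero => simp [z2]
  | succ n ih =>
    rw [Finset.sum_range_succ, ih]
    linear_combination z2 (f n)

lemma green (F : ℕ → ℕ → ZMod 2) (l w : ℕ)
    (hF : ∀ x < l, ∀ y < w, (F x y + F (x+1) (y+1)) * (F (x+1) y + F x (y+1)) = 0) :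
    ∑ y ∈ Finset.range w, (F 0 y * F 0 (y+1)) + ∑ y ∈ Finset.range w, (F l y * F l (y+1)) +
    (∑ x ∈ Finset.range l, (F x 0 * F (x+1) 0) + ∑ x ∈ Finset.range l, (F x w * F (x+1) w)) = 0 := by
  have h0 : ∑ x ∈ Finset.range l, ∑ y ∈ Finset.range w,
      ((F x y * F x (y+1) + F (x+1) y * F (x+1) (y+1)) +
       (F x y * F (x+1) y + F x (y+1) * F (x+1) (y+1))) = 0 := by
    refine Finset.sum_eq_zero fun x hx => Finset.sum_eq_zero fun y hy => ?_
    rw [← hF x (Finset.mem_range.1 hx) y (Finset.mem_range.1 hy)]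
    ring
  simp only [Finset.sum_add_distrib (s := Finset.range w), Finset.sum_add_distrib (s := Finset.range l)] at h0
  rw [← h0, ← Finset.sum_add_distrib (s := Finset.range l), ← Finset.sum_add_distrib (s := Finset.range l)]
  congr 1
  · rw [← Finset.sum_add_distrib]
    rw [tele (fun x => ∑ y ∈ Finset.range w, F x y * F x (y+1)) l]
    simp only [Finset.sum_add_distrib]
  · rw [← Finset.sum_add_distrib]
    refine Finset.sum_congr rfl fun x _ => ?_
    rw [← Finset.sum_add_distrib]
    exact (tele (fun y => F x y * F (x+1) y) w).symm

lemma exists_one {k : ℤ} (hk : k = 0 ∨ k = 1) {l w : ℕ} {A B : ℤ × ℤ → ℤ × ℤ → Prop}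
    (hAs : ∀ a b, A a b → A b a) (hBs : ∀ a b, B a b → B b a)
    (hB : ∀ a b, Vx (1 - k) l w a → Vx (1 - k) l w b → Dg a b →
      ¬ A (a.1, b.2) (b.1, a.2) → B a b)
    (hnA : ∀ a b, Vx k l w a → a.1 = 0 → Vx k l w b → b.1 = l → ¬ Relation.ReflTransGen A a b)
    (hnB : ∀ a b, Vx (1 - k) l w a → a.2 = 0 → Vx (1 - k) l w b → b.2 = w →
      ¬ Relation.ReflTransGen B a b) : False := by
  let L : ℤ × ℤ → Prop := fun p => ∃ a, Vx k l w a ∧ a.1 = 0 ∧ Relation.ReflTransGen A a p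
  let D : ℤ × ℤ → Prop := fun p => ∃ a, Vx (1 - k) l w a ∧ a.2 = 0 ∧ Relation.ReflTransGen B a p
  let t : ℤ × ℤ → ZMod 2 := fun p => if (p.1 + p.2) % 2 = k ∧ L p then 1 else 0
  let u : ℤ × ℤ → ZMod 2 := fun p => if (p.1 + p.2) % 2 ≠ k ∧ D p then 1 else 0
  have hLA : ∀ a b, A a b → (L a ↔ L b) := by
    intro a b h
    constructor
    · rintro ⟨c, h1, h2, h3⟩
      exact ⟨c, h1, h2, h3.tail h⟩
    · rintro ⟨c, h1, h2, h3⟩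
      exact ⟨c, h1, h2, h3.tail (hAs _ _ h)⟩
  have hDB : ∀ a b, B a b → (D a ↔ D b) := by
    intro a b h
    constructor
    · rintro ⟨c, h1, h2, h3⟩
      exact ⟨c, h1, h2, h3.tail h⟩
    · rintro ⟨c, h1, h2, h3⟩
      exact ⟨c, h1, h2, h3.tail (hBs _ _ h)⟩
  have t0 : ∀ p, (p.1 + p.2) % 2 ≠ k → t p = 0 := fun p h => if_neg (fun hh => h hh.1)
  have u0 : ∀ p, (p.1 + p.2) % 2 = k → u p = 0 := fun p h => if_neg (fun hh => hh.1 h)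
  have tL : ∀ p, Vx k l w p → p.1 = 0 → t p = 1 := fun p h h0 =>
    if_pos ⟨h.2.2.2.2, p, h, h0, Relation.ReflTransGen.refl⟩
  have tR : ∀ p, Vx k l w p → p.1 = l → t p = 0 := fun p h h0 =>
    if_neg (by rintro ⟨_, c, h1, h2, h3⟩; exact hnA c p h1 h2 h h0 h3)
  have uB : ∀ p, Vx (1 - k) l w p → p.2 = 0 → u p = 1 := fun p h h0 =>
    if_pos ⟨by unfold Vx at h; omega, p, h, h0, Relation.ReflTransGen.refl⟩
  have uT : ∀ p, Vx (1 - k) l w p → p.2 = w → u p = 0 := fun p h h0 =>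
    if_neg (by rintro ⟨_, c, h1, h2, h3⟩; exact hnB c p h1 h2 h h0 h3)
  have tA : ∀ a b, (a.1 + a.2) % 2 = k → (b.1 + b.2) % 2 = k → A a b → t a = t b := by
    intro a b ha hb h
    simp only [t, ha, hb, hLA a b h]
  have uBB : ∀ a b, (a.1 + a.2) % 2 ≠ k → (b.1 + b.2) % 2 ≠ k → B a b → u a = u b := by
    intro a b ha hb h
    simp only [u, hDB a b h, iff_true_intro ha, iff_true_intro hb]
  let F : ℕ → ℕ → ZMod 2 := fun x y => t (x, y) + u (x, y)
  have hG := green F l w ?_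
  · -- boundary terms
    have sL : ∑ y ∈ Finset.range w, (F 0 y * F 0 (y+1)) = u (0, 0) + u (0, w) := by
      have := tele (fun y => u (0, (y : ℤ))) w
      simp only [Nat.cast_zero] at this
      rw [← this]
      refine Finset.sum_congr rfl fun y hy => ?_
      have hy := Finset.mem_range.1 hy
      by_cases hp : ((y : ℤ)) % 2 = k
      · have a1 := u0 (0, (y : ℤ)) (by simp only; omega)
        have a2 := t0 (0, ((y + 1 : ℕ) : ℤ)) (by dsimp only; push_cast; omega)
        have a3 := tL (0, (y : ℤ)) (by simp only [Vx]; omega) rfl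
        simp only [F, Nat.cast_zero, a1, a2, a3]
        ring
      · have a1 := t0 (0, (y : ℤ)) (by simp only; omega)
        have a2 := u0 (0, ((y + 1 : ℕ) : ℤ)) (by dsimp only; push_cast; omega)
        have a3 := tL (0, ((y + 1 : ℕ) : ℤ)) (by refine ⟨?_, ?_, ?_, ?_, ?_⟩ <;> dsimp only <;> omega) rfl
        simp only [F, Nat.cast_zero, a1, a2, a3]
        ring
    have sB : ∑ x ∈ Finset.range l, (F x 0 * F (x+1) 0) = t (0, 0) + t (l, 0) := by
      have := tele (fun x => t ((x : ℤ), 0)) l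
      simp only [Nat.cast_zero] at this
      rw [← this]
      refine Finset.sum_congr rfl fun x hx => ?_
      have hx := Finset.mem_range.1 hx
      by_cases hp : ((x : ℤ)) % 2 = k
      · have a1 := u0 ((x : ℤ), 0) (by simp only; omega)
        have a2 := t0 (((x + 1 : ℕ) : ℤ), 0) (by dsimp only; push_cast; omega)
        have a3 := uB (((x + 1 : ℕ) : ℤ), 0) (by refine ⟨?_, ?_, ?_, ?_, ?_⟩ <;> dsimp only <;> omega) rfl
        simp only [F, Nat.cast_zero, a1, a2, a3]
        ring
      · have a1 := t0 ((x : ℤ), 0) (by simp only; omega)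
        have a2 := u0 (((x + 1 : ℕ) : ℤ), 0) (by dsimp only; push_cast; omega)
        have a3 := uB ((x : ℤ), 0) (by simp only [Vx]; omega) rfl
        simp only [F, Nat.cast_zero, a1, a2, a3]
        ring
    have FR : ∀ y : ℕ, y ≤ w → ((l : ℤ) + y) % 2 = k → F l y = 0 := by
      intro y hy hp
      have a1 := u0 ((l : ℤ), (y : ℤ)) hp
      have a2 := tR ((l : ℤ), (y : ℤ)) (by simp only [Vx]; omega) rfl
      simp only [F, a1, a2, add_zero]
    have FT : ∀ x : ℕ, x ≤ l → ((x : ℤ) + w) % 2 ≠ k → F x w = 0 := by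
      intro x hx hp
      have a1 := t0 ((x : ℤ), (w : ℤ)) hp
      have a2 := uT ((x : ℤ), (w : ℤ)) (by simp only [Vx]; omega) rfl
      simp only [F, a1, a2, add_zero]
    have sR : ∑ y ∈ Finset.range w, (F l y * F l (y+1)) = 0 := by
      refine Finset.sum_eq_zero fun y hy => ?_
      have hy := Finset.mem_range.1 hy
      by_cases hp : ((l : ℤ) + y) % 2 = k
      · rw [FR y (by omega) hp, zero_mul]
      · rw [FR (y + 1) (by omega) (by push_cast; omega), mul_zero]
    have sT : ∑ x ∈ Finset.range l, (F x w * F (x+1) w) = 0 := by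
      refine Finset.sum_eq_zero fun x hx => ?_
      have hx := Finset.mem_range.1 hx
      by_cases hp : ((x : ℤ) + w) % 2 = k
      · rw [FT (x + 1) (by omega) (by push_cast; omega), mul_zero]
      · rw [FT x (by omega) hp, zero_mul]
    have c1 : u (0, (w : ℤ)) = 0 := by
      by_cases hp : (0 + (w : ℤ)) % 2 = k
      · exact u0 _ hp
      · exact uT _ (by simp only [Vx]; omega) rfl
    have c2 : t ((l : ℤ), 0) = 0 := by
      by_cases hp : ((l : ℤ) + 0) % 2 = k
      · exact tR _ (by simp only [Vx]; omega) rfl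
      · exact t0 _ hp
    have c3 : t (0, 0) + u (0, 0) = 1 := by
      rcases hk with rfl | rfl
      · rw [tL (0, 0) (by simp [Vx]) rfl, u0 (0, 0) (by simp), add_zero]
      · rw [uB (0, 0) (by simp [Vx]) rfl, t0 (0, 0) (by simp), zero_add]
    rw [sL, sB, sR, sT, c1, c2] at hG
    have : (1 : ZMod 2) = 0 := by
      rw [← c3, ← hG]
      ring
    exact absurd this (by decide)
  · intro x hx y hy
    have key : ∀ a b c d : ℤ × ℤ, a = (c.1, d.2) → b = (d.1, c.2) →
        (a.1 + a.2) % 2 = k → (b.1 + b.2) % 2 = k → Vx (1 - k) l w c → Vx (1 - k) l w d →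
        Dg c d → ((t a + u a) + (t b + u b)) * ((t c + u c) + (t d + u d)) = 0 := by
      intro a b c d hab hbb ha hb hc hd hcd
      have hc' : (c.1 + c.2) % 2 ≠ k := by unfold Vx at hc; omega
      have hd' : (d.1 + d.2) % 2 ≠ k := by unfold Vx at hd; omega
      rw [u0 a ha, u0 b hb, t0 c hc', t0 d hd']
      by_cases h : A a b
      · rw [tA a b ha hb h]
        simp [z2]
      · rw [uBB c d hc' hd' (hB c d hc hd hcd (by rw [← hab, ← hbb]; exact h))]
        simp [z2]
    by_cases hp : ((x : ℤ) + y) % 2 = k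
    · have := key ((x : ℤ), (y : ℤ)) (((x + 1 : ℕ) : ℤ), ((y + 1 : ℕ) : ℤ))
        ((x : ℤ), ((y + 1 : ℕ) : ℤ)) (((x + 1 : ℕ) : ℤ), (y : ℤ)) rfl rfl hp
        (by push_cast; omega) (by refine ⟨?_, ?_, ?_, ?_, ?_⟩ <;> dsimp only <;> omega)
        (by refine ⟨?_, ?_, ?_, ?_, ?_⟩ <;> dsimp only <;> omega) (by simp only [Dg]; push_cast; omega)
      simp only [F]
      rw [← this]
      ring
    · have := key ((x : ℤ), ((y + 1 : ℕ) : ℤ)) (((x + 1 : ℕ) : ℤ), (y : ℤ))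
        ((x : ℤ), (y : ℤ)) (((x + 1 : ℕ) : ℤ), ((y + 1 : ℕ) : ℤ)) rfl rfl
        (by push_cast; omega) (by push_cast; omega) (by refine ⟨?_, ?_, ?_, ?_, ?_⟩ <;> dsimp only <;> omega)
        (by refine ⟨?_, ?_, ?_, ?_, ?_⟩ <;> dsimp only <;> omega) (by simp only [Dg]; push_cast; omega)
      simp only [F]
      rw [← this]
      ring

lemma complEdge_mk (a b : ℤ × ℤ) : complEdge s(a, b) = s((a.1, b.2), (b.1, a.2)) := rfl

lemma complEdge_invol (e : Sym2 (ℤ × ℤ)) : complEdge (complEdge e) = e := by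
  induction e with
  | _ a b => simp [complEdge_mk]

lemma mem_image_compl (S : Set (Sym2 (ℤ × ℤ))) (e : Sym2 (ℤ × ℤ)) :
    e ∈ complEdge '' S ↔ complEdge e ∈ S := by
  constructor
  · rintro ⟨d, hd, rfl⟩
    rwa [complEdge_invol]
  · intro h
    exact ⟨_, h, complEdge_invol e⟩

lemma mem_V {i l w : ℕ} (hi : i = 1 ∨ i = 2) (p : ℤ × ℤ) :
    p ∈ HammockV i l w ↔ Vx ((i : ℤ) - 1) l w p := by
  simp only [HammockV, Set.mem_setOf_eq, par_iff hi, HammockVAll, Vx]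
  tauto

lemma mem_Vdual {i l w : ℕ} (hi : i = 1 ∨ i = 2) (p : ℤ × ℤ) :
    p ∈ HammockVAll l w \ HammockV i l w ↔ Vx (1 - ((i : ℤ) - 1)) l w p := by
  rw [Set.mem_diff, mem_V hi]
  simp only [HammockVAll, Set.mem_setOf_eq, Vx]
  omega

lemma mem_E {i l w : ℕ} (hi : i = 1 ∨ i = 2) (a b : ℤ × ℤ) :
    s(a, b) ∈ HammockE i l w ↔
      Vx ((i : ℤ) - 1) l w a ∧ Vx ((i : ℤ) - 1) l w b ∧ Dg a b := by
  simp only [HammockE, Set.mem_setOf_eq, mem_EAll, Sym2.mem_iff, forall_eq_or_imp, forall_eq,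
    par_iff hi, HammockVAll, Vx]
  tauto

lemma mem_Edual {i l w : ℕ} (hi : i = 1 ∨ i = 2) (a b : ℤ × ℤ) :
    s(a, b) ∈ HammockEAll l w \ HammockE i l w ↔
      Vx (1 - ((i : ℤ) - 1)) l w a ∧ Vx (1 - ((i : ℤ) - 1)) l w b ∧ Dg a b := by
  rw [Set.mem_diff, mem_E hi, mem_EAll]
  simp only [HammockVAll, Set.mem_setOf_eq, Vx, Dg]
  omega

end HamAux

/-- Σ ⊆ E^{(i)}_{l,w} is a pathset of H^{(i)}_{l,w} if and only if
the set of complementary edges Σ̄ is a cutset of the dual network H̄^{(i)}_{l,w}. -/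
theorem isPathset_iff_compl_isCutset_dual (l w : ℕ) (hl : 0 < l) (hw : 0 < w)
    (i : ℕ) (hi : i = 1 ∨ i = 2) (S : Set (Sym2 (ℤ × ℤ)))
    (hSE : S ⊆ HammockE i l w) :
    (hammock i l w).IsPathset S ↔ (hammockDual i l w).IsCutset (complEdge '' S) := by
  have hA : ∀ a b, s(a, b) ∈ S →
      HamAux.Vx ((i : ℤ) - 1) l w a ∧ HamAux.Vx ((i : ℤ) - 1) l w b ∧ HamAux.Dg a b :=
    fun a b h => (HamAux.mem_E hi a b).1 (hSE h)
  have hAs : ∀ a b, s(a, b) ∈ S → s(b, a) ∈ S := fun a b h => by rwa [Sym2.eq_swap]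
  have hsub : complEdge '' S ⊆ (hammockDual i l w).edges := by
    rintro _ ⟨e, he, rfl⟩
    induction e with
    | _ a b =>
      have := hA a b he
      refine (HamAux.mem_Edual hi _ _).2 ?_
      simp only [HamAux.Vx, HamAux.Dg] at *
      omega
  have hBiff : ∀ a b, s(a, b) ∈ (hammockDual i l w).edges \ complEdge '' S ↔
      HamAux.Vx (1 - ((i : ℤ) - 1)) l w a ∧ HamAux.Vx (1 - ((i : ℤ) - 1)) l w b ∧
      HamAux.Dg a b ∧ ¬ s((a.1, b.2), (b.1, a.2)) ∈ S := by
    intro a b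
    rw [Set.mem_diff, HamAux.mem_image_compl, HamAux.complEdge_mk]
    have := HamAux.mem_Edual (l := l) (w := w) hi a b
    simp only [hammockDual]
    tauto
  unfold HNetwork.IsCutset
  rw [HamAux.isPathset_iff (hammock i l w) l w (fun e he => he.1) S hSE,
    HamAux.isPathset_iff (hammockDual i l w) l w (fun e he => he.1) _ Set.diff_subset]
  constructor
  · rintro ⟨a, ha, b, hb, h⟩
    refine ⟨hsub, ?_⟩
    rintro ⟨c, hc, d, hd, h'⟩
    exact HamAux.not_both hAs hA (fun a b hh => (hBiff a b).1 hh) ha.2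
      ((HamAux.mem_V hi _).1 hb.1) hb.2 h hc.2 ((HamAux.mem_Vdual hi _).1 hd.1) hd.2 h'
  · rintro ⟨_, hn⟩
    by_contra hcon
    refine HamAux.exists_one (k := (i : ℤ) - 1) (l := l) (w := w)
      (A := fun a b => s(a, b) ∈ S)
      (B := fun a b => s(a, b) ∈ (hammockDual i l w).edges \ complEdge '' S)
      (by omega) hAs (fun a b h => by rwa [Sym2.eq_swap])
      (fun a b h1 h2 h3 h4 => (hBiff a b).2 ⟨h1, h2, h3, h4⟩) ?_ ?_
    · intro a b ha ha0 hb hb0 h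
      exact hcon ⟨a, ⟨(HamAux.mem_V hi _).2 ha, ha0⟩, b, ⟨(HamAux.mem_V hi _).2 hb, hb0⟩, h⟩
    · intro a b ha ha0 hb hb0 h
      exact hn ⟨a, ⟨(HamAux.mem_Vdual hi _).2 ha, ha0⟩, b,
        ⟨(HamAux.mem_Vdual hi _).2 hb, hb0⟩, h⟩
end

section
/- Let l, w be positive integers and i ∈ {1,2}, and write 2/i for the other index (2/1 = 2, 2/2 = 1). For every p ∈ [0,1], the reliability polynomials of hammock networks satisfy h^{(i)}_{l,w}(p) = 1 − h^{(2/i)}_{w,l}(1 − p). -/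
open scoped Classical

theorem hk_par {i : ℕ} (hi : i = 1 ∨ i = 2) (a : ℤ × ℤ) :
    HammockPar i a ↔ (a.1 + a.2 + i) % 2 = 1 := by
  rcases hi with rfl | rfl
  · simp only [HammockPar, if_true, Int.even_iff]; push_cast; omega
  · simp only [HammockPar, Int.odd_iff]; norm_num

/-- The edge of kind `i` in the unit cell with lower left corner `(x,y)`. -/
noncomputable def hkDiag (i : ℕ) (x y : ℤ) : Sym2 (ℤ × ℤ) :=
  if (x + y + i) % 2 = 1 then s((x, y), (x + 1, y + 1)) else s((x + 1, y), (x, y + 1))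

theorem hk_diag_iff (i : ℕ) (x y : ℤ) (a b : ℤ × ℤ) :
    s(a, b) = hkDiag i x y ↔
      ((a.1 = x ∧ b.1 = x + 1) ∨ (a.1 = x + 1 ∧ b.1 = x)) ∧
      ((a.2 = y ∧ b.2 = y + 1) ∨ (a.2 = y + 1 ∧ b.2 = y)) ∧ (a.1 + a.2 + i) % 2 = 1 := by
  obtain ⟨a1, a2⟩ := a
  obtain ⟨b1, b2⟩ := b
  unfold hkDiag
  split_ifs with h <;> simp only [Sym2.eq_iff, Prod.mk.injEq] <;> omega

theorem hk_mem_E {i : ℕ} (hi : i = 1 ∨ i = 2) (l w : ℕ) (e : Sym2 (ℤ × ℤ)) :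
    e ∈ HammockE i l w ↔
      ∃ x y : ℤ, 0 ≤ x ∧ x < l ∧ 0 ≤ y ∧ y < w ∧ e = hkDiag i x y := by
  induction e using Sym2.ind with
  | _ a b =>
  simp only [hk_diag_iff]
  constructor
  · rintro ⟨⟨a', b', he, ha, hb, h1, h2⟩, hp⟩
    have hpa := (hk_par hi a).1 (hp a (by simp))
    have hab : a ∈ HammockVAll l w ∧ b ∈ HammockVAll l w ∧ |a.1 - b.1| = 1 ∧ |a.2 - b.2| = 1 := by
      rcases Sym2.eq_iff.1 he with ⟨rfl, rfl⟩ | ⟨rfl, rfl⟩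
      · exact ⟨ha, hb, h1, h2⟩
      · exact ⟨hb, ha, by rwa [abs_sub_comm], by rwa [abs_sub_comm]⟩
    obtain ⟨ha, hb, h1, h2⟩ := hab
    simp only [HammockVAll, Set.mem_ofPred_eq] at ha hb
    refine ⟨min a.1 b.1, min a.2 b.2, ?_⟩
    rw [abs_eq (by norm_num)] at h1 h2
    omega
  · rintro ⟨x, y, hx0, hx1, hy0, hy1, h1, h2, h3⟩
    refine ⟨⟨a, b, rfl, ?_, ?_, ?_, ?_⟩, ?_⟩
    · simp only [HammockVAll, Set.mem_ofPred_eq]; omega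
    · simp only [HammockVAll, Set.mem_ofPred_eq]; omega
    · rw [abs_eq (by norm_num)]; omega
    · rw [abs_eq (by norm_num)]; omega
    · intro p hp
      rw [hk_par hi]
      rcases Sym2.mem_iff.1 hp with rfl | rfl <;> omega

theorem hk_chain_iff (P : Set (Sym2 (ℤ × ℤ))) (vs : List (ℤ × ℤ)) :
    (∀ e ∈ xEdges vs, e ∈ P) ↔ vs.IsChain (fun a b => s(a, b) ∈ P) := by
  induction vs with
  | nil => simp [xEdges]
  | cons a t ih =>
    cases t with
    | nil => simp [xEdges]
    | cons b t =>
      rw [List.isChain_cons_cons, ← ih]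
      simp [xEdges]

/-- Connectivity form of being a pathset. -/
def HkConn (i l w : ℕ) (P : Set (Sym2 (ℤ × ℤ))) : Prop :=
  ∃ s ∈ (hammock i l w).src, ∃ t ∈ (hammock i l w).tgt,
    Relation.ReflTransGen (fun a b => s(a, b) ∈ P) s t

theorem hk_pathset_iff {i : ℕ} (hi : i = 1 ∨ i = 2) (l w : ℕ) (P : Set (Sym2 (ℤ × ℤ)))
    (hP : P ⊆ HammockE i l w) : (hammock i l w).IsPathset P ↔ HkConn i l w P := by
  constructor
  · rintro ⟨-, vs, hne, -, hs, ht, he⟩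
    exact ⟨_, hs, _, ht, List.relationReflTransGen_of_exists_isChain vs
      ((hk_chain_iff P vs).1 he) hne⟩
  · rintro ⟨s, hs, t, ht, h⟩
    have hstep : ∀ a b, s(a, b) ∈ P → b - a ∈ XStep := by
      intro a b hab
      obtain ⟨x, y, -, -, -, -, he⟩ := (hk_mem_E hi l w _).1 (hP hab)
      rw [hk_diag_iff] at he
      simp only [XStep, Set.mem_insert_iff, Set.mem_singleton_iff, Prod.ext_iff, Prod.fst_sub,
        Prod.snd_sub]
      omega
    let G : SimpleGraph (ℤ × ℤ) :=
      { Adj := fun a b => s(a, b) ∈ P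
        symm := ⟨fun a b h => by rwa [Sym2.eq_swap]⟩
        loopless := ⟨fun a h => by
          have := hstep a a h
          simp [XStep, Prod.ext_iff] at this⟩ }
    have hr : G.Reachable s t := (G.reachable_iff_reflTransGen s t).2 h
    obtain ⟨p, hp⟩ := hr.exists_isPath
    have hc := p.isChain_adj_support
    refine ⟨hP, p.support, p.support_ne_nil, ⟨hp.support_nodup, ?_⟩, ?_, ?_, ?_⟩
    · exact hc.imp (fun a b h => hstep a b h)
    · simpa using hs
    · simpa using ht
    · exact (hk_chain_iff P _).2 hc

theorem hk_tele (u : ℕ → ZMod 2) (n : ℕ) :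
    ∑ k ∈ Finset.range n, (u k + u (k + 1)) = u 0 + u n := by
  induction n with
  | zero => simp [CharTwo.add_self_eq_zero]
  | succ n ih =>
    rw [Finset.sum_range_succ, ih]
    linear_combination CharTwo.add_self_eq_zero (u n)

theorem hk_stokes (f : ℕ → ℕ → ZMod 2) (l w : ℕ)
    (h : ∀ x < l, ∀ y < w, (f x y + f (x + 1) (y + 1)) * (f (x + 1) y + f x (y + 1)) = 0) :
    ∑ x ∈ Finset.range l, (f x 0 * f (x + 1) 0 + f x w * f (x + 1) w)
      + ∑ y ∈ Finset.range w, (f 0 y * f 0 (y + 1) + f l y * f l (y + 1)) = 0 := by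
  have h1 : ∀ x, f x 0 * f (x + 1) 0 + f x w * f (x + 1) w
      = ∑ y ∈ Finset.range w, (f x y * f (x + 1) y + f x (y + 1) * f (x + 1) (y + 1)) :=
    fun x => (hk_tele (fun y => f x y * f (x + 1) y) w).symm
  have h2 : ∀ y, f 0 y * f 0 (y + 1) + f l y * f l (y + 1)
      = ∑ x ∈ Finset.range l, (f x y * f x (y + 1) + f (x + 1) y * f (x + 1) (y + 1)) :=
    fun y => (hk_tele (fun x => f x y * f x (y + 1)) l).symm
  simp only [h1, h2]
  rw [Finset.sum_comm (s := Finset.range w), ← Finset.sum_add_distrib]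
  refine Finset.sum_eq_zero fun x hx => ?_
  rw [← Finset.sum_add_distrib]
  refine Finset.sum_eq_zero fun y hy => ?_
  rw [← h x (Finset.mem_range.1 hx) y (Finset.mem_range.1 hy)]
  ring

theorem hk_core_b (f : ℕ → ℕ → ZMod 2) (l w i : ℕ)
    (h : ∀ x < l, ∀ y < w, (f x y + f (x + 1) (y + 1)) * (f (x + 1) y + f x (y + 1)) = 0)
    (hL : ∀ y ≤ w, (0 + y + i) % 2 = 1 → f 0 y = 1)
    (hR : ∀ y ≤ w, (l + y + i) % 2 = 1 → f l y = 0)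
    (hB : ∀ x ≤ l, (x + 0 + i) % 2 = 0 → f x 0 = 1)
    (hT : ∀ x ≤ l, (x + w + i) % 2 = 0 → f x w = 0) : False := by
  have hs := hk_stokes f l w h
  have e1 : ∑ x ∈ Finset.range l, (f x 0 * f (x + 1) 0 + f x w * f (x + 1) w)
      = if i % 2 = 1 then f 0 0 else 0 := by
    have := hk_tele (fun x => if (x + i) % 2 = 1 then f x 0 else 0) l
    have h2 : (if (l + i) % 2 = 1 then f l 0 else 0) = 0 := by
      split_ifs with hh
      · exact hR 0 (by omega) (by omega)
      · rfl
    simp only [h2, add_zero, zero_add] at this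
    rw [← this]
    refine Finset.sum_congr rfl fun x hx => ?_
    have hx := Finset.mem_range.1 hx
    rcases Nat.mod_two_eq_zero_or_one (x + i) with hm | hm
    · rw [if_neg (by omega), if_pos (by omega), hB x (by omega) (by omega)]
      rcases Nat.mod_two_eq_zero_or_one (x + w + i) with hn | hn
      · rw [hT x (by omega) hn]; ring
      · rw [hT (x + 1) (by omega) (by omega)]; ring
    · rw [if_pos (by omega), if_neg (by omega), hB (x + 1) (by omega) (by omega)]
      rcases Nat.mod_two_eq_zero_or_one (x + w + i) with hn | hn
      · rw [hT x (by omega) hn]; ring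
      · rw [hT (x + 1) (by omega) (by omega)]; ring
  have e2 : ∑ y ∈ Finset.range w, (f 0 y * f 0 (y + 1) + f l y * f l (y + 1))
      = if i % 2 = 0 then f 0 0 else 0 := by
    have := hk_tele (fun y => if (y + i) % 2 = 0 then f 0 y else 0) w
    have h2 : (if (w + i) % 2 = 0 then f 0 w else 0) = 0 := by
      split_ifs with hh
      · exact hT 0 (by omega) (by omega)
      · rfl
    simp only [h2, add_zero, zero_add] at this
    rw [← this]
    refine Finset.sum_congr rfl fun y hy => ?_
    have hy := Finset.mem_range.1 hy
    have hz : f l y * f l (y + 1) = 0 := by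
      rcases Nat.mod_two_eq_zero_or_one (l + y + i) with hn | hn
      · rw [hR (y + 1) (by omega) (by omega)]; ring
      · rw [hR y (by omega) (by omega)]; ring
    rw [hz]
    rcases Nat.mod_two_eq_zero_or_one (y + i) with hm | hm
    · rw [if_pos (by omega), if_neg (by omega), hL (y + 1) (by omega) (by omega)]; ring
    · rw [if_neg (by omega), if_pos (by omega), hL y (by omega) (by omega)]; ring
  rw [e1, e2] at hs
  rcases Nat.mod_two_eq_zero_or_one i with hm | hm
  · rw [if_neg (by omega), if_pos hm, hB 0 (by omega) (by omega)] at hs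
    simp at hs
  · rw [if_pos hm, if_neg (by omega), hL 0 (by omega) (by omega)] at hs
    simp at hs

theorem hk_src {i : ℕ} (hi : i = 1 ∨ i = 2) (l w : ℕ) (a : ℤ × ℤ) :
    a ∈ (hammock i l w).src ↔ a.1 = 0 ∧ 0 ≤ a.2 ∧ a.2 ≤ w ∧ (a.1 + a.2 + i) % 2 = 1 := by
  simp only [hammock, HammockV, HammockVAll, Set.mem_ofPred_eq, hk_par hi]
  omega

theorem hk_tgt {i : ℕ} (hi : i = 1 ∨ i = 2) (l w : ℕ) (a : ℤ × ℤ) :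
    a ∈ (hammock i l w).tgt ↔ a.1 = l ∧ 0 ≤ a.2 ∧ a.2 ≤ w ∧ (a.1 + a.2 + i) % 2 = 1 := by
  simp only [hammock, HammockV, HammockVAll, Set.mem_ofPred_eq, hk_par hi]
  omega

/-- At least one of a primal and a dual crossing exists. -/
theorem hk_dual_b {i j : ℕ} (hi : i = 1 ∨ i = 2) (hij : i + j = 3) (l w : ℕ)
    (P P' : Set (Sym2 (ℤ × ℤ)))
    (hd : ∀ x y : ℤ, 0 ≤ x → x < l → 0 ≤ y → y < w →
      hkDiag i x y ∈ P ∨ hkDiag j y x ∈ P') :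
    HkConn i l w P ∨ HkConn j w l P' := by
  have hj : j = 1 ∨ j = 2 := by omega
  by_contra hcon
  rw [not_or] at hcon
  obtain ⟨h1, h2⟩ := hcon
  let A : ℤ × ℤ → Prop := fun a => ∃ s ∈ (hammock i l w).src,
    Relation.ReflTransGen (fun a b => s(a, b) ∈ P) s a
  let B : ℤ × ℤ → Prop := fun a => ∃ s ∈ (hammock j w l).src,
    Relation.ReflTransGen (fun a b => s(a, b) ∈ P') s a
  have hA : ∀ a b, s(a, b) ∈ P → (A a ↔ A b) := by
    intro a b hab
    refine ⟨fun ⟨s, hs, h⟩ => ⟨s, hs, h.tail hab⟩, fun ⟨s, hs, h⟩ => ⟨s, hs, h.tail ?_⟩⟩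
    rwa [Sym2.eq_swap]
  have hB : ∀ a b, s(a, b) ∈ P' → (B a ↔ B b) := by
    intro a b hab
    refine ⟨fun ⟨s, hs, h⟩ => ⟨s, hs, h.tail hab⟩, fun ⟨s, hs, h⟩ => ⟨s, hs, h.tail ?_⟩⟩
    rwa [Sym2.eq_swap]
  let f : ℕ → ℕ → ZMod 2 := fun x y =>
    if (x + y + i) % 2 = 1 then (if A (x, y) then 1 else 0) else (if B (y, x) then 1 else 0)
  have hf1 : ∀ x y : ℕ, (x + y + i) % 2 = 1 → f x y = if A (x, y) then 1 else 0 :=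
    fun x y h => if_pos h
  have hf0 : ∀ x y : ℕ, (x + y + i) % 2 = 0 → f x y = if B (y, x) then 1 else 0 :=
    fun x y h => if_neg (by omega)
  apply hk_core_b f l w i
  · intro x hx y hy
    rcases Nat.mod_two_eq_zero_or_one (x + y + i) with hm | hm
    · rw [hf0 x y hm, hf0 (x + 1) (y + 1) (by omega), hf1 (x + 1) y (by omega),
        hf1 x (y + 1) (by omega)]
      rcases hd x y (by omega) (by omega) (by omega) (by omega) with h | h
      · have e : s((((x + 1 : ℕ) : ℤ), (y : ℤ)), ((x : ℤ), ((y + 1 : ℕ) : ℤ))) = hkDiag i x y := by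
          rw [hk_diag_iff]; push_cast; omega
        rw [← e] at h
        simp only [hA _ _ h, CharTwo.add_self_eq_zero, mul_zero]
      · have e : s(((y : ℤ), (x : ℤ)), (((y + 1 : ℕ) : ℤ), ((x + 1 : ℕ) : ℤ))) = hkDiag j y x := by
          rw [hk_diag_iff]; push_cast; omega
        rw [← e] at h
        simp only [hB _ _ h, CharTwo.add_self_eq_zero, zero_mul]
    · rw [hf1 x y hm, hf1 (x + 1) (y + 1) (by omega), hf0 (x + 1) y (by omega),
        hf0 x (y + 1) (by omega)]
      rcases hd x y (by omega) (by omega) (by omega) (by omega) with h | h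
      · have e : s(((x : ℤ), (y : ℤ)), (((x + 1 : ℕ) : ℤ), ((y + 1 : ℕ) : ℤ))) = hkDiag i x y := by
          rw [hk_diag_iff]; push_cast; omega
        rw [← e] at h
        simp only [hA _ _ h, CharTwo.add_self_eq_zero, zero_mul]
      · have e : s(((y : ℤ), ((x + 1 : ℕ) : ℤ)), (((y + 1 : ℕ) : ℤ), (x : ℤ))) = hkDiag j y x := by
          rw [hk_diag_iff]; push_cast; omega
        rw [← e] at h
        simp only [hB _ _ h, CharTwo.add_self_eq_zero, mul_zero]
  · intro y hy hm
    rw [hf1 0 y hm, if_pos]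
    exact ⟨(((0 : ℕ) : ℤ), (y : ℤ)), (hk_src hi l w _).2 (by dsimp only; omega), .refl⟩
  · intro y hy hm
    rw [hf1 l y hm, if_neg]
    rintro ⟨s, hs, h⟩
    exact h1 ⟨s, hs, _, (hk_tgt hi l w _).2 (by push_cast; omega), h⟩
  · intro x hx hm
    rw [hf0 x 0 hm, if_pos]
    exact ⟨(((0 : ℕ) : ℤ), (x : ℤ)), (hk_src hj w l _).2 (by dsimp only; omega), .refl⟩
  · intro x hx hm
    rw [hf0 x w hm, if_neg]
    rintro ⟨s, hs, h⟩
    exact h2 ⟨s, hs, _, (hk_tgt hj w l _).2 (by push_cast; omega), h⟩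

/-- Indicator with values in `ZMod 2`. -/
noncomputable def hkInd (p : Prop) : ZMod 2 := if p then 1 else 0

/-- A (transposed) dual path gives a crossing-parity function. -/
theorem hk_cross {i j : ℕ} (hij : i + j = 3) (l w : ℕ)
    (P' : Set (Sym2 (ℤ × ℤ))) (hj : j = 1 ∨ j = 2) (hP' : P' ⊆ HammockE j w l)
    (s t : ℤ × ℤ) (h : Relation.ReflTransGen (fun a b => s(a, b) ∈ P') s t) :
    ∃ c : ℤ → ℤ → ZMod 2,
      (∀ x y, hkDiag j y x ∉ P' → c (x + 1) y = c x y) ∧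
      (∀ x y : ℤ, (x + y + i) % 2 = 1 →
        c x y + c x (y - 1) = hkInd (s.1 = y ∧ s.2 < x) + hkInd (t.1 = y ∧ t.2 < x)) ∧
      (∀ y, c 0 y = 0) ∧
      (∀ y, c l y = hkInd (s.1 ≤ y) + hkInd (t.1 ≤ y)) := by
  induction h with
  | refl =>
    exact ⟨fun _ _ => 0, by simp, by simp [CharTwo.add_self_eq_zero], by simp,
      by simp [CharTwo.add_self_eq_zero]⟩
  | @tail t t' _ hstep ih =>
    obtain ⟨c, c1, c2, c3, c4⟩ := ih
    obtain ⟨y0, x0, hy0, hy1, hx0, hx1, he⟩ := (hk_mem_E hj w l _).1 (hP' hstep)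
    have he' := (hk_diag_iff _ _ _ _ _).1 he
    refine ⟨fun x y => c x y + hkInd (y = y0 ∧ x0 < x), ?_, ?_, ?_, ?_⟩
    · intro x y hxy
      have hne : ¬ (x = x0 ∧ y = y0) := by
        rintro ⟨rfl, rfl⟩
        exact hxy (he ▸ hstep)
      have : (y = y0 ∧ x0 < x + 1) ↔ (y = y0 ∧ x0 < x) := by omega
      simp only [c1 x y hxy, this]
    · intro x y hxy
      have key : hkInd (y = y0 ∧ x0 < x) + hkInd (y - 1 = y0 ∧ x0 < x)
          = hkInd (t.1 = y ∧ t.2 < x) + hkInd (t'.1 = y ∧ t'.2 < x) := by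
        obtain ⟨ha, hb, hc⟩ := he'
        have hh : ((y = y0 ∧ x0 < x ↔ t.1 = y ∧ t.2 < x) ∧
            (y - 1 = y0 ∧ x0 < x ↔ t'.1 = y ∧ t'.2 < x)) ∨
            ((y = y0 ∧ x0 < x ↔ t'.1 = y ∧ t'.2 < x) ∧
            (y - 1 = y0 ∧ x0 < x ↔ t.1 = y ∧ t.2 < x)) := by
          rcases ha with ha | ha
          · left; omega
          · right; omega
        rcases hh with ⟨q1, q2⟩ | ⟨q1, q2⟩
        · rw [q1, q2]
        · rw [q1, q2, add_comm]
      have := c2 x y hxy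
      linear_combination this + key - CharTwo.add_self_eq_zero (hkInd (t.1 = y ∧ t.2 < x)) +
        2 * CharTwo.add_self_eq_zero (hkInd (t.1 = y ∧ t.2 < x))
    · intro y
      have : ¬ (y = y0 ∧ x0 < 0) := by omega
      simp [c3, hkInd, this]
    · intro y
      have key : hkInd (y = y0 ∧ x0 < (l : ℤ)) = hkInd (t.1 ≤ y) + hkInd (t'.1 ≤ y) := by
        unfold hkInd
        obtain ⟨ha, hb, hc⟩ := he'
        split_ifs <;> first | (exfalso; omega) | rfl
      have := c4 y
      simp only [key, this]
      linear_combination CharTwo.add_self_eq_zero (hkInd (t.1 ≤ y))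

theorem hk_dual_a {i j : ℕ} (hi : i = 1 ∨ i = 2) (hij : i + j = 3) (l w : ℕ) (hw : 0 < w)
    (P P' : Set (Sym2 (ℤ × ℤ))) (hP : P ⊆ HammockE i l w) (hP' : P' ⊆ HammockE j w l)
    (hd : ∀ x y : ℤ, hkDiag i x y ∈ P → hkDiag j y x ∉ P')
    (h1 : HkConn i l w P) (h2 : HkConn j w l P') : False := by
  have hj : j = 1 ∨ j = 2 := by omega
  obtain ⟨s, hs, t, ht, h⟩ := h2
  obtain ⟨c, c1, c2, c3, c4⟩ := hk_cross hij l w P' hj hP' s t h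
  rw [hk_src hj] at hs
  rw [hk_tgt hj] at ht
  obtain ⟨u, hu, v, hv, h⟩ := h1
  rw [hk_src hi] at hu
  rw [hk_tgt hi] at hv
  have c2' : ∀ x y : ℤ, (x + y + i) % 2 = 1 → 0 < y → y < w → c x y = c x (y - 1) := by
    intro x y hxy hy0 hy1
    have := c2 x y hxy
    have n1 : ¬ (s.1 = y ∧ s.2 < x) := by omega
    have n2 : ¬ (t.1 = y ∧ t.2 < x) := by omega
    simp only [hkInd, n1, n2, if_false, add_zero] at this
    exact CharTwo.add_eq_zero.1 this
  have inv : ((v.2 < w → c v.1 v.2 = 0) ∧ (0 < v.2 → c v.1 (v.2 - 1) = 0)) := by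
    clear hv
    induction h with
    | refl => rw [hu.1]; exact ⟨fun _ => c3 _, fun _ => c3 _⟩
    | @tail a b _ hab ih =>
      obtain ⟨x, y, hx0, hx1, hy0, hy1, he⟩ := (hk_mem_E hi l w _).1 (hP hab)
      have hc := c1 x y (hd x y (he ▸ hab))
      obtain ⟨e1, e2, e3⟩ := (hk_diag_iff _ _ _ _ _).1 he
      have hby : c b.1 y = 0 := by
        have hay : c a.1 y = 0 := by
          rcases e2 with ⟨e, -⟩ | ⟨e, -⟩
          · rw [← e]; exact ih.1 (by omega)
          · have : y = a.2 - 1 := by omega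
            rw [this]; exact ih.2 (by omega)
        rcases e1 with ⟨e, e'⟩ | ⟨e, e'⟩
        · rw [e', hc, ← e, hay]
        · rw [e', ← hc, ← e, hay]
      rcases e2 with ⟨e, e'⟩ | ⟨e, e'⟩
      · have q : c b.1 (b.2 - 1) = 0 := by
          have : b.2 - 1 = y := by omega
          rw [this, hby]
        exact ⟨fun hlt => by rw [c2' b.1 b.2 (by omega) (by omega) hlt, q], fun _ => q⟩
      · have q : c b.1 b.2 = 0 := by rw [e', hby]
        exact ⟨fun _ => q, fun hlt => by rw [← c2' b.1 b.2 (by omega) hlt (by omega), q]⟩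
  rw [hv.1] at inv
  have fin : ∀ y : ℤ, 0 ≤ y → y < w → c l y ≠ 0 := by
    intro y hy0 hy1
    rw [c4]
    have n1 : s.1 ≤ y := by omega
    have n2 : ¬ t.1 ≤ y := by omega
    simp [hkInd, n1, n2]
  by_cases hlt : v.2 < w
  · exact fin _ hv.2.1 hlt (inv.1 hlt)
  · exact fin _ (by omega) (by omega) (inv.2 (by omega))

/-- Transposed complementary edge. -/
def hkFlip : Sym2 (ℤ × ℤ) → Sym2 (ℤ × ℤ) :=
  Sym2.lift ⟨fun a b => s((b.2, a.1), (a.2, b.1)), fun _ _ => Sym2.eq_swap⟩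

theorem hkFlip_flip (e : Sym2 (ℤ × ℤ)) : hkFlip (hkFlip e) = e := by
  induction e using Sym2.ind with
  | _ a b => simp [hkFlip, Sym2.eq_swap]

theorem hkFlip_diag {i j : ℕ} (hij : i + j = 3) (x y : ℤ) :
    hkFlip (hkDiag i x y) = hkDiag j y x := by
  have : ∀ a b, s(a, b) = hkDiag i x y → hkFlip s(a, b) = hkDiag j y x := by
    intro a b h
    rw [hk_diag_iff] at h
    simp only [hkFlip, Sym2.lift_mk]
    rw [hk_diag_iff]
    simp only
    omega
  revert this
  generalize hkDiag i x y = e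
  intro this
  induction e using Sym2.ind with
  | _ a b => exact this a b rfl

theorem hkFlip_mem {i j : ℕ} (hi : i = 1 ∨ i = 2) (hij : i + j = 3) (l w : ℕ)
    (e : Sym2 (ℤ × ℤ)) (he : e ∈ HammockE i l w) : hkFlip e ∈ HammockE j w l := by
  obtain ⟨x, y, h1, h2, h3, h4, rfl⟩ := (hk_mem_E hi l w e).1 he
  rw [hkFlip_diag hij]
  exact (hk_mem_E (by omega) w l _).2 ⟨y, x, h3, h4, h1, h2, rfl⟩

theorem hk_mem_fin {i : ℕ} (hi : i = 1 ∨ i = 2) (l w : ℕ) (e : Sym2 (ℤ × ℤ)) :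
    e ∈ hammockEFinset i l w ↔ e ∈ HammockE i l w := by
  unfold hammockEFinset
  rw [Finset.mem_filter, and_iff_right_iff_imp]
  rintro ⟨⟨a, b, rfl, ha, hb, -, -⟩, -⟩
  simp only [HammockVAll, Set.mem_ofPred_eq] at ha hb
  simp only [Finset.mk_mem_sym2_iff, Finset.mem_product, Finset.mem_Icc]
  omega

theorem hk_diag_inj (i : ℕ) (x y x' y' : ℤ) (h : hkDiag i x y = hkDiag i x' y') :
    x = x' ∧ y = y' := by
  have : ∀ a b, s(a, b) = hkDiag i x y → s(a, b) = hkDiag i x' y' → x = x' ∧ y = y' := by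
    intro a b h h'
    rw [hk_diag_iff] at h h'
    omega
  revert this h
  generalize hkDiag i x y = e
  generalize hkDiag i x' y' = e'
  rintro rfl this
  induction e using Sym2.ind with
  | _ a b => exact this a b rfl rfl

theorem hk_card {i : ℕ} (hi : i = 1 ∨ i = 2) (l w : ℕ) :
    (hammockEFinset i l w).card = l * w := by
  have : hammockEFinset i l w = ((Finset.Ico (0 : ℤ) l) ×ˢ (Finset.Ico (0 : ℤ) w)).image
      (fun q => hkDiag i q.1 q.2) := by
    ext e
    rw [hk_mem_fin hi, hk_mem_E hi]
    simp only [Finset.mem_image, Finset.mem_product, Finset.mem_Ico, Prod.exists]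
    constructor
    · rintro ⟨x, y, h1, h2, h3, h4, rfl⟩
      exact ⟨x, y, ⟨⟨h1, h2⟩, h3, h4⟩, rfl⟩
    · rintro ⟨x, y, ⟨⟨h1, h2⟩, h3, h4⟩, rfl⟩
      exact ⟨x, y, h1, h2, h3, h4, rfl⟩
  rw [this, Finset.card_image_of_injective]
  · simp
  · rintro ⟨x, y⟩ ⟨x', y'⟩ h
    have := hk_diag_inj _ _ _ _ _ h
    exact Prod.ext this.1 this.2

/-- The dual state of a set of edges. -/
noncomputable def hkDual (i l w : ℕ) (P : Finset (Sym2 (ℤ × ℤ))) : Finset (Sym2 (ℤ × ℤ)) :=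
  (hammockEFinset i l w \ P).image hkFlip

theorem hk_inj : Function.Injective hkFlip :=
  (show Function.Involutive hkFlip from hkFlip_flip).injective

theorem hk_mem_dual (i l w : ℕ) (P : Finset (Sym2 (ℤ × ℤ))) (e : Sym2 (ℤ × ℤ)) :
    e ∈ hkDual i l w P ↔ hkFlip e ∈ hammockEFinset i l w ∧ hkFlip e ∉ P := by
  unfold hkDual
  rw [Finset.mem_image]
  constructor
  · rintro ⟨e', h, rfl⟩
    rw [hkFlip_flip]
    exact Finset.mem_sdiff.1 h
  · intro h
    exact ⟨_, Finset.mem_sdiff.2 h, hkFlip_flip e⟩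

theorem hk_dual_sub {i j : ℕ} (hi : i = 1 ∨ i = 2) (hij : i + j = 3) (l w : ℕ)
    (P : Finset (Sym2 (ℤ × ℤ))) : hkDual i l w P ⊆ hammockEFinset j w l := by
  intro e he
  rw [hk_mem_dual, hk_mem_fin hi] at he
  rw [hk_mem_fin (by omega)]
  have := hkFlip_mem hi hij l w _ he.1
  rwa [hkFlip_flip] at this

theorem hk_dual_dual {i j : ℕ} (hi : i = 1 ∨ i = 2) (hij : i + j = 3) (l w : ℕ)
    (P : Finset (Sym2 (ℤ × ℤ))) (hP : P ⊆ hammockEFinset i l w) :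
    hkDual j w l (hkDual i l w P) = P := by
  ext e
  rw [hk_mem_dual, hk_mem_dual, hkFlip_flip, hk_mem_fin hi, hk_mem_fin (by omega)]
  constructor
  · rintro ⟨h1, h2⟩
    have := hkFlip_mem (by omega) (by omega : j + i = 3) w l _ h1
    rw [hkFlip_flip] at this
    by_contra h
    exact h2 ⟨this, h⟩
  · intro h
    exact ⟨hkFlip_mem hi hij l w _ ((hk_mem_fin hi l w e).1 (hP h)), fun h' => h'.2 h⟩

theorem hk_duality {i j : ℕ} (hi : i = 1 ∨ i = 2) (hij : i + j = 3) (l w : ℕ) (hw : 0 < w)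
    (P : Finset (Sym2 (ℤ × ℤ))) (hP : P ⊆ hammockEFinset i l w) :
    (hammock j w l).IsPathset ↑(hkDual i l w P) ↔ ¬ (hammock i l w).IsPathset ↑P := by
  have hj : j = 1 ∨ j = 2 := by omega
  have s1 : (↑P : Set (Sym2 (ℤ × ℤ))) ⊆ HammockE i l w :=
    fun e he => (hk_mem_fin hi l w e).1 (hP he)
  have s2 : (↑(hkDual i l w P) : Set (Sym2 (ℤ × ℤ))) ⊆ HammockE j w l :=
    fun e he => (hk_mem_fin hj w l e).1 (hk_dual_sub hi hij l w P he)
  rw [hk_pathset_iff hi l w _ s1, hk_pathset_iff hj w l _ s2]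
  have hji : j + i = 3 := by omega
  constructor
  · intro h2 h1
    refine hk_dual_a hi hij l w hw _ _ s1 s2 ?_ h1 h2
    intro x y h h'
    rw [Finset.mem_coe, hk_mem_dual, hkFlip_diag hji] at h'
    exact h'.2 h
  · intro h
    refine (hk_dual_b hi hij l w (↑P) (↑(hkDual i l w P)) ?_).resolve_left h
    intro x y a b c d
    rw [or_iff_not_imp_left]
    intro hn
    rw [Finset.mem_coe, hk_mem_dual, hkFlip_diag hji, hk_mem_fin hi, hk_mem_E hi]
    exact ⟨⟨x, y, a, b, c, d, rfl⟩, hn⟩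

/-- For every p ∈ [0,1], h^{(i)}_{l,w}(p) = 1 − h^{(2/i)}_{w,l}(1 − p). -/
theorem hammockRel_dual (l w : ℕ) (hl : 0 < l) (hw : 0 < w)
    (i : ℕ) (hi : i = 1 ∨ i = 2) (p : ℝ) (hp0 : 0 ≤ p) (hp1 : p ≤ 1) :
    hammockRel i l w p = 1 - hammockRel (otherKind i) w l (1 - p) := by
  have hij : i + otherKind i = 3 := by
    rcases hi with rfl | rfl <;> simp [otherKind]
  generalize otherKind i = j at hij
  have hj : j = 1 ∨ j = 2 := by omega
  have hji : j + i = 3 := by omega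
  have htot := Finset.sum_pow_mul_eq_add_pow p (1 - p) (hammockEFinset i l w)
  rw [hk_card hi, add_sub_cancel, one_pow, ← Finset.sum_filter_add_sum_filter_not _
    (fun P : Finset (Sym2 (ℤ × ℤ)) => (hammock i l w).IsPathset ↑P)] at htot
  rw [eq_sub_iff_add_eq]
  refine Eq.trans ?_ htot
  unfold hammockRel
  congr 1
  symm
  refine Finset.sum_bij' (fun P _ => hkDual i l w P) (fun Q _ => hkDual j w l Q) ?_ ?_ ?_ ?_ ?_
  · intro P hP
    rw [Finset.mem_filter, Finset.mem_powerset] at hP ⊢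
    exact ⟨hk_dual_sub hi hij l w P, (hk_duality hi hij l w hw P hP.1).2 hP.2⟩
  · intro Q hQ
    rw [Finset.mem_filter, Finset.mem_powerset] at hQ ⊢
    have hs := hk_dual_sub hj hji w l Q
    refine ⟨hs, (hk_duality hi hij l w hw _ hs).1 ?_⟩
    rw [hk_dual_dual hj hji w l Q hQ.1]
    exact hQ.2
  · intro P hP
    rw [Finset.mem_filter, Finset.mem_powerset] at hP
    exact hk_dual_dual hi hij l w P hP.1
  · intro Q hQ
    rw [Finset.mem_filter, Finset.mem_powerset] at hQ
    exact hk_dual_dual hj hji w l Q hQ.1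
  · intro P hP
    rw [Finset.mem_filter, Finset.mem_powerset] at hP
    have hc : (hkDual i l w P).card = l * w - P.card := by
      unfold hkDual
      rw [Finset.card_image_of_injective _ hk_inj, Finset.card_sdiff_of_subset hP.1, hk_card hi]
    have hle : P.card ≤ l * w := hk_card hi l w ▸ Finset.card_le_card hP.1
    have hsub : w * l - (l * w - P.card) = P.card := by
      rw [mul_comm w l]; omega
    rw [hc, hsub, sub_sub_cancel, mul_comm]
end

section
/- Let l, w be positive integers with at least one of l, w odd. Then for every p ∈ [0,1], the reliability polynomial of the hammock network of dimensions (l,w) satisfies h_{l,w}(p) = 1 − h_{w,l}(1 − p). -/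
open scoped Classical

/-! ### Topological core: discrete duality in a rectangle -/

theorem hd_core_a (l w : ℕ) (hw : 0 < w) (k : ℤ) (s t : ℤ → ℤ → ZMod 2)
    (hs0 : ∀ x y, x ≤ 0 → s x y = 1) (hs1 : ∀ x y, (l : ℤ) ≤ x → s x y = 0)
    (ht0 : ∀ x y, y ≤ 0 → t x y = 1) (ht1 : ∀ x y, (w : ℤ) ≤ y → t x y = 0)
    (h1 : ∀ x y : ℤ, 0 ≤ x → x < l → 0 ≤ y → y < w → (x + y + k) % 2 = 0 →
      s x y = s (x + 1) (y + 1) ∨ t (x + 1) y = t x (y + 1))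
    (h2 : ∀ x y : ℤ, 0 ≤ x → x < l → 0 ≤ y → y < w → (x + y + k) % 2 = 1 →
      s (x + 1) y = s x (y + 1) ∨ t x y = t (x + 1) (y + 1)) : False := by
  obtain ⟨d, hd⟩ : ∃ d : ℤ → ℤ → ZMod 2, d = fun x y =>
      if (x + y + k) % 2 = 0 then (s x y + s (x + 1) (y + 1)) * t (x + 1) y
      else (s (x + 1) y + s x (y + 1)) * t x y := ⟨_, rfl⟩
  have de : ∀ x y, (x + y + k) % 2 = 0 → d x y = (s x y + s (x + 1) (y + 1)) * t (x + 1) y := by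
    intro x y h; simp [hd, h]
  have dodd : ∀ x y, (x + y + k) % 2 = 1 → d x y = (s (x + 1) y + s x (y + 1)) * t x y := by
    intro x y h; simp [hd, h]
  have de' : ∀ x y : ℤ, 0 ≤ x → 0 ≤ y → y < w → (x + y + k) % 2 = 0 →
      d x y = (s x y + s (x + 1) (y + 1)) * t x (y + 1) := by
    intro x y hx hy hyw h
    rw [de x y h]
    by_cases hxl : x < l
    · rcases h1 x y hx hxl hy hyw h with h' | h'
      · rw [h', CharTwo.add_self_eq_zero]; simp
      · rw [h']
    · rw [hs1 x y (by omega), hs1 (x + 1) _ (by omega)]; simp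
  have dodd' : ∀ x y : ℤ, 0 ≤ x → 0 ≤ y → y < w → (x + y + k) % 2 = 1 →
      d x y = (s (x + 1) y + s x (y + 1)) * t (x + 1) (y + 1) := by
    intro x y hx hy hyw h
    rw [dodd x y h]
    by_cases hxl : x < l
    · rcases h2 x y hx hxl hy hyw h with h' | h'
      · rw [h', CharTwo.add_self_eq_zero]; simp
      · rw [h']
    · rw [hs1 x _ (by omega), hs1 (x + 1) _ (by omega)]; simp
  obtain ⟨F, hF⟩ : ∃ F : ℕ → ℤ → ZMod 2, F = fun n y => ∑ j ∈ Finset.range n, d (j : ℤ) y :=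
    ⟨_, rfl⟩
  have F0 : ∀ y, F 0 y = 0 := by intro y; simp [hF]
  have FS : ∀ n y, F (n + 1) y = F n y + d (n : ℤ) y := by
    intro n y; simp [hF, Finset.sum_range_succ]
  have c1 : ∀ y : ℤ, 0 < y → y < w → ∀ n : ℕ, ((n : ℤ) + y + k) % 2 = 0 →
      F n y = F n (y - 1) := by
    intro y hy hyw n
    induction n using Nat.twoStepInduction with
    | zero => intro _; simp [F0]
    | one =>
      intro h
      rw [FS, FS, F0, F0]
      push_cast at h ⊢
      rw [dodd 0 y (by omega), de' 0 (y - 1) (by omega) (by omega) (by omega) (by omega)]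
      rw [hs0 0 _ le_rfl, hs0 0 _ le_rfl]
      simp only [sub_add_cancel, zero_add]
      ring
    | more n ih _ =>
      intro h
      push_cast at h
      have h' := ih (by omega)
      rw [FS, FS, FS, FS, h']
      push_cast
      rw [de n y (by omega), dodd (n + 1) y (by omega),
        dodd' n (y - 1) (by omega) (by omega) (by omega) (by omega),
        de' (n + 1) (y - 1) (by omega) (by omega) (by omega) (by omega)]
      simp only [sub_add_cancel]
      have e2 : (2 : ZMod 2) = 0 := rfl
      linear_combination (s (n + 1) (y + 1) - s (n + 1) (y - 1)) * t (n + 1) y * e2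
  have c2 : ∀ n : ℕ, ((n : ℤ) + k) % 2 = 0 → F n 0 = 1 + s n 0 := by
    have e2 : (2 : ZMod 2) = 0 := rfl
    intro n
    induction n using Nat.twoStepInduction with
    | zero =>
      intro _
      rw [F0, hs0 _ _ (by simp)]; rfl
    | one =>
      intro h
      rw [FS, F0]
      push_cast at h ⊢
      rw [dodd 0 0 (by omega), ht0 _ _ le_rfl, hs0 0 _ le_rfl]
      simp only [zero_add]
      ring
    | more n ih _ =>
      intro h
      push_cast at h
      rw [FS, FS, ih (by omega)]
      push_cast
      rw [de n 0 (by omega), dodd (n + 1) 0 (by omega), ht0 _ _ le_rfl]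
      have : (n : ℤ) + 1 + 1 = n + 2 := by ring
      rw [this]
      linear_combination (s n 0 + s (n + 1) (0 + 1)) * e2
  have dl : ∀ y, d l y = 0 := by
    intro y
    rcases Int.emod_two_eq_zero_or_one (l + y + k) with h | h
    · rw [de _ _ h, hs1 _ _ le_rfl, hs1 _ _ (by omega)]; simp
    · rw [dodd _ _ h, hs1 _ _ le_rfl, hs1 _ _ (by omega)]; simp
  have Fl : ∀ y, F (l + 1) y = F l y := by intro y; rw [FS, dl]; simp
  have c3 : ∀ m : ℕ, m < w → F l m = 1 := by
    intro m
    induction m with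
    | zero =>
      intro _
      rcases Int.emod_two_eq_zero_or_one (l + k) with h | h
      · have := c2 l h
        rw [hs1 _ _ le_rfl] at this
        simpa using this
      · have := c2 (l + 1) (by push_cast; omega)
        rw [hs1 _ _ (by push_cast; omega), Fl] at this
        simpa using this
    | succ m ih =>
      intro hm
      have ihm := ih (by omega)
      rcases Int.emod_two_eq_zero_or_one (l + (m + 1) + k) with h | h
      · have := c1 (m + 1) (by omega) (by omega) l h
        push_cast
        rw [this]; simpa using ihm
      · have := c1 (m + 1) (by omega) (by omega) (l + 1) (by push_cast; omega)
        rw [Fl, Fl] at this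
        push_cast
        rw [this]; simpa using ihm
  have c4 : F l ((w - 1 : ℕ) : ℤ) = 0 := by
    rw [hF]
    apply Finset.sum_eq_zero
    intro j _
    rcases Int.emod_two_eq_zero_or_one (j + ((w - 1 : ℕ) : ℤ) + k) with h | h
    · rw [de' _ _ (by omega) (by omega) (by omega) h, ht1 _ _ (by omega)]; simp
    · rw [dodd' _ _ (by omega) (by omega) (by omega) h, ht1 _ _ (by omega)]; simp
  rw [c3 (w - 1) (by omega)] at c4
  exact one_ne_zero c4

/-- A step along an open diagonal of kind `k`; `A` is the set of open cells. -/
def HDStep (k : ℤ) (A : Finset (ℤ × ℤ)) (a b : ℤ × ℤ) : Prop :=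
  (a.1 + a.2 + k) % 2 = 0 ∧ ∃ x y : ℤ, (x, y) ∈ A ∧
    ((a = (x, y) ∧ b = (x + 1, y + 1)) ∨ (a = (x + 1, y + 1) ∧ b = (x, y)) ∨
     (a = (x + 1, y) ∧ b = (x, y + 1)) ∨ (a = (x, y + 1) ∧ b = (x + 1, y)))

theorem HDStep.symm {k : ℤ} {A : Finset (ℤ × ℤ)} {a b : ℤ × ℤ} (h : HDStep k A a b) :
    HDStep k A b a := by
  obtain ⟨hp, x, y, hA, h⟩ := h
  refine ⟨?_, x, y, hA, ?_⟩
  · rcases h with ⟨rfl, rfl⟩ | ⟨rfl, rfl⟩ | ⟨rfl, rfl⟩ | ⟨rfl, rfl⟩ <;> simp only at hp ⊢ <;> omega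
  · tauto

theorem hd_core_b (l w : ℕ) (k : ℤ) (A : Finset (ℤ × ℤ)) (D : ℤ → ℤ → ZMod 2)
    (hAc : ∀ x y, (x, y) ∈ A → 0 ≤ x ∧ x < l ∧ 0 ≤ y ∧ y < w)
    (hD : ∀ x y, D x y ≠ 0 → 0 ≤ x ∧ x < l ∧ 0 ≤ y ∧ y < w ∧ (x, y) ∉ A)
    (u v : ℤ) (hu0 : 0 ≤ u) (hul : u ≤ l) (hup : (u + k) % 2 = 1) (hw : 0 < w)
    (hdeg : ∀ x y, (x + y + k) % 2 = 1 →
      D x y + D (x - 1) y + D x (y - 1) + D (x - 1) (y - 1) =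
        (if (x, y) = (u, 0) then 1 else 0) + (if (x, y) = (v, (w : ℤ)) then 1 else 0))
    (a b : ℤ × ℤ) (ha : a.1 = 0) (ha2 : 0 ≤ a.2 ∧ a.2 ≤ w) (hb : b.1 = l) 
    (hab : Relation.ReflTransGen (HDStep k A) a b) : False := by
  have D0 : ∀ x y, (x < 0 ∨ (l : ℤ) ≤ x ∨ y < 0 ∨ (w : ℤ) ≤ y ∨ (x, y) ∈ A) → D x y = 0 := by
    intro x y h
    by_contra hne
    have := hD x y hne
    rcases h with h | h | h | h | h
    · omega
    · omega
    · omega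
    · omega
    · exact this.2.2.2.2 h
  obtain ⟨F, hF⟩ : ∃ F : ℕ → ℤ → ZMod 2, F = fun n y => ∑ j ∈ Finset.range n, D (j : ℤ) y :=
    ⟨_, rfl⟩
  have F0 : ∀ y, F 0 y = 0 := by intro y; simp [hF]
  have FS : ∀ n y, F (n + 1) y = F n y + D (n : ℤ) y := by
    intro n y; simp [hF, Finset.sum_range_succ]
  have c1 : ∀ y : ℤ, 0 ≤ y → y < w → ∀ n : ℕ, ((n : ℤ) + y + k) % 2 = 0 →
      F n y + F n (y - 1) = if y = 0 ∧ u < n then 1 else 0 := by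
    intro y hy hyw n
    induction n using Nat.twoStepInduction with
    | zero => intro _; rw [if_neg (by push_cast; omega)]; simp [F0]
    | one =>
      intro h
      rw [FS, FS, F0, F0]
      push_cast at h ⊢
      have := hdeg 0 y (by omega)
      rw [D0 (0 - 1) y (by omega), D0 (0 - 1) (y - 1) (by omega)] at this
      have hne : ((0 : ℤ), y) ≠ (v, (w : ℤ)) := by
        intro h; rw [Prod.mk.injEq] at h; omega
      rw [if_neg hne] at this
      simp only [add_zero, zero_add] at this ⊢
      rw [this]
      congr 1
      rw [Prod.mk.injEq]
      apply propext; omega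
    | more n ih _ =>
      intro h
      push_cast at h
      have h' := ih (by omega)
      rw [FS, FS, FS, FS]
      push_cast
      have := hdeg (n + 1) y (by omega)
      have hne : ((n : ℤ) + 1, y) ≠ (v, (w : ℤ)) := by
        intro h; rw [Prod.mk.injEq] at h; omega
      rw [if_neg hne] at this
      simp only [add_sub_cancel_right, add_zero] at this
      have e : (if y = 0 ∧ u < (n : ℤ) + 2 then (1 : ZMod 2) else 0) =
          (if y = 0 ∧ u < (n : ℤ) then 1 else 0) + (if ((n : ℤ) + 1, y) = (u, 0) then 1 else 0) := by
        simp only [Prod.mk.injEq]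
        by_cases hy0 : y = 0
        · by_cases h3 : u < n
          · rw [if_pos (by omega), if_pos (by omega), if_neg (by omega)]; simp
          · by_cases h4 : u = n + 1
            · rw [if_pos (by omega), if_neg (by omega), if_pos (by omega)]; simp
            · rw [if_neg (by omega), if_neg (by omega), if_neg (by omega)]; simp
        · rw [if_neg (by omega), if_neg (by omega), if_neg (by omega)]; simp
      rw [e, ← h', ← this]
      ring
  have Fl : ∀ y, F (l + 1) y = F l y := by intro y; rw [FS, D0 _ _ (by omega)]; simp
  have c3 : ∀ m : ℕ, m < w → F l m = 1 := by
    intro m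
    induction m with
    | zero =>
      intro _
      have Fm : ∀ n, F n (0 - 1) = 0 := by
        intro n
        rw [hF]
        exact Finset.sum_eq_zero (fun j _ => D0 _ _ (by omega))
      rcases Int.emod_two_eq_zero_or_one (l + k) with h | h
      · have := c1 0 le_rfl (by omega) l (by omega)
        rw [if_pos ⟨rfl, by omega⟩, Fm] at this
        simpa using this
      · have := c1 0 le_rfl (by omega) (l + 1) (by push_cast; omega)
        rw [if_pos ⟨rfl, by push_cast; omega⟩, Fm, Fl] at this
        simpa using this
    | succ m ih =>
      intro hm
      have ihm := ih (by omega)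
      have : F l ((m : ℤ) + 1) + F l ((m + 1 : ℤ) - 1) = 0 := by
        rcases Int.emod_two_eq_zero_or_one (l + (m + 1) + k) with h | h
        · rw [c1 (m + 1) (by omega) (by omega) l h, if_neg (by omega)]
        · rw [← Fl, ← Fl, c1 (m + 1) (by omega) (by omega) (l + 1) (by push_cast; omega),
            if_neg (by omega)]
      rw [add_sub_cancel_right, ihm] at this
      push_cast
      have e : (1 : ZMod 2) = -1 := rfl
      rw [eq_neg_of_add_eq_zero_left this]; rfl
  have key : ∀ c, Relation.ReflTransGen (HDStep k A) a c →
      ∃ n m : ℕ, c = ((n : ℤ), (m : ℤ)) ∧ n ≤ l ∧ m ≤ w ∧ (m < w → F n m = 0) ∧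
        (0 < m → F n ((m : ℤ) - 1) = 0) := by
    intro c hc
    induction hc with
    | refl =>
      refine ⟨0, a.2.toNat, ?_, ?_, ?_, ?_, ?_⟩
      · ext
        · simp [ha]
        · simp [ha2.1]
      · omega
      · omega
      · intro _; exact F0 _
      · intro _; exact F0 _
    | @tail c e _ hce ih =>
      obtain ⟨n, m, rfl, hn, hm, hup', hdn⟩ := ih
      have hce2 := hce.symm.1
      obtain ⟨hp, x, y, hA, hce⟩ := hce
      have hc := hAc x y hA
      have hD0 := D0 x y (by tauto)
      obtain ⟨x, rfl⟩ := Int.eq_ofNat_of_zero_le hc.1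
      obtain ⟨y, rfl⟩ := Int.eq_ofNat_of_zero_le hc.2.2.1
      have hFx := FS x y
      rw [hD0, add_zero] at hFx
      have up : ∀ n m : ℕ, ((n : ℤ) + m + k) % 2 = 0 → 0 < m → m < w → F n m = F n ((m : ℤ) - 1) := by
        intro n m h h0 h1
        have := c1 m (by omega) (by omega) n h
        rw [if_neg (by omega)] at this
        rw [eq_neg_of_add_eq_zero_left this, ZMod.neg_eq_self_mod_two]
      rcases hce with ⟨h1, rfl⟩ | ⟨h1, rfl⟩ | ⟨h1, rfl⟩ | ⟨h1, rfl⟩ <;>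
        rw [Prod.mk.injEq] at h1 <;> simp only at hce2
      · obtain ⟨rfl, rfl⟩ : n = x ∧ m = y := by omega
        have : F (n + 1) m = 0 := by rw [hFx]; exact hup' (by omega)
        refine ⟨n + 1, m + 1, by push_cast; rfl, by omega, by omega, ?_, ?_⟩
        · intro h; rw [up _ _ (by push_cast; omega) (by omega) h]; simpa using this
        · intro h; simpa using this
      · obtain ⟨rfl, rfl⟩ : n = x + 1 ∧ m = y + 1 := by omega
        have : F x y = 0 := by rw [← hFx]; simpa using hdn (by omega)
        refine ⟨x, y, rfl, by omega, by omega, fun _ => this, ?_⟩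
        intro h; rw [← up _ _ (by omega) h (by omega)]; exact this
      · obtain ⟨rfl, rfl⟩ : n = x + 1 ∧ m = y := by omega
        have : F x m = 0 := by rw [← hFx]; exact hup' (by omega)
        refine ⟨x, m + 1, by push_cast; rfl, by omega, by omega, ?_, ?_⟩
        · intro h; rw [up _ _ (by push_cast; omega) (by omega) h]; simpa using this
        · intro h; simpa using this
      · obtain ⟨rfl, rfl⟩ : n = x ∧ m = y + 1 := by omega
        have : F (n + 1) y = 0 := by rw [hFx]; simpa using hdn (by omega)
        refine ⟨n + 1, y, by push_cast; rfl, by omega, by omega, fun _ => this, ?_⟩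
        intro h; rw [← up _ _ (by push_cast; omega) h (by omega)]; exact this
  obtain ⟨n, m, rfl, hn, hm, h1, h2⟩ := key b hab
  have hnl : n = l := by simpa using hb
  subst hnl
  by_cases hmw : m < w
  · have := h1 hmw
    rw [c3 m hmw] at this
    exact one_ne_zero this
  · have := h2 (by omega)
    have e : (m : ℤ) - 1 = ((w - 1 : ℕ) : ℤ) := by omega
    rw [e, c3 (w - 1) (by omega)] at this
    exact one_ne_zero this

/-- The unit cells of the rectangle. -/
noncomputable def hdCells (l w : ℕ) : Finset (ℤ × ℤ) := Finset.Ico (0 : ℤ) l ×ˢ Finset.Ico (0 : ℤ) w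

theorem mem_hdCells {l w : ℕ} {x y : ℤ} :
    (x, y) ∈ hdCells l w ↔ 0 ≤ x ∧ x < l ∧ 0 ≤ y ∧ y < w := by
  simp [hdCells, and_assoc]

/-- Left-right connection by open diagonals of kind `k`. -/
def HDConn (k : ℤ) (l w : ℕ) (A : Finset (ℤ × ℤ)) : Prop :=
  ∃ a b : ℤ × ℤ, (a ∈ HammockVAll l w ∧ (a.1 + a.2 + k) % 2 = 0 ∧ a.1 = 0) ∧
    (b ∈ HammockVAll l w ∧ (b.1 + b.2 + k) % 2 = 0 ∧ b.1 = l) ∧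
    Relation.ReflTransGen (HDStep k A) a b

/-- Bottom-top connection by open diagonals of kind `k`. -/
def HDVConn (k : ℤ) (l w : ℕ) (A : Finset (ℤ × ℤ)) : Prop :=
  ∃ a b : ℤ × ℤ, (a ∈ HammockVAll l w ∧ (a.1 + a.2 + k) % 2 = 0 ∧ a.2 = 0) ∧
    (b ∈ HammockVAll l w ∧ (b.1 + b.2 + k) % 2 = 0 ∧ b.2 = w) ∧
    Relation.ReflTransGen (HDStep k A) a b

theorem hd_chain (k : ℤ) (B : Finset (ℤ × ℤ)) (a b : ℤ × ℤ)
    (h : Relation.ReflTransGen (HDStep k B) a b) :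
    ∃ D : ℤ → ℤ → ZMod 2, (∀ x y, D x y ≠ 0 → (x, y) ∈ B) ∧
      ∀ x y, (x + y + k) % 2 = 0 →
        D x y + D (x - 1) y + D x (y - 1) + D (x - 1) (y - 1) =
        (if (x, y) = a then 1 else 0) + (if (x, y) = b then 1 else 0) := by
  induction h with
  | refl =>
    refine ⟨fun _ _ => 0, by simp, ?_⟩
    intro x y _
    simp only [CharTwo.add_self_eq_zero]
  | @tail b c _ hbc ih =>
    obtain ⟨D, h1, h2⟩ := ih
    obtain ⟨hp, X, Y, hB, hbc⟩ := hbc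
    refine ⟨fun x y => D x y + if x = X ∧ y = Y then 1 else 0, ?_, ?_⟩
    · intro x y hne
      by_cases h : x = X ∧ y = Y
      · rw [h.1, h.2]; exact hB
      · simp only [if_neg h, add_zero] at hne
        exact h1 x y hne
    · intro x y hxy
      have key : (if x = X ∧ y = Y then (1 : ZMod 2) else 0) + (if x - 1 = X ∧ y = Y then 1 else 0) +
          (if x = X ∧ y - 1 = Y then 1 else 0) + (if x - 1 = X ∧ y - 1 = Y then 1 else 0) =
          (if (x, y) = b then 1 else 0) + (if (x, y) = c then 1 else 0) := by
        rcases hbc with ⟨rfl, rfl⟩ | ⟨rfl, rfl⟩ | ⟨rfl, rfl⟩ | ⟨rfl, rfl⟩ <;>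
          simp only [Prod.mk.injEq] at hp ⊢ <;>
          split_ifs <;> first | rfl | (exfalso; omega)
      have := h2 x y hxy
      have e2 : (2 : ZMod 2) = 0 := rfl
      simp only []
      linear_combination this + key + (if (x, y) = b then 1 else 0) * e2

theorem hd_dual (l w : ℕ) (hw : 0 < w) (k : ℤ) (A : Finset (ℤ × ℤ)) (hA : A ⊆ hdCells l w) :
    HDConn k l w A ↔ ¬ HDVConn (k + 1) l w (hdCells l w \ A) := by
  constructor
  · rintro ⟨a, b, ⟨haV, hap, ha0⟩, ⟨hbV, hbp, hbl⟩, hab⟩ ⟨⟨u, u2⟩, ⟨v, v2⟩, ⟨huV, hup, hu0⟩, ⟨hvV, hvp, hvw⟩, huv⟩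
    obtain ⟨D, h1, h2⟩ := hd_chain _ _ _ _ huv
    simp only at hu0 hvw hup
    subst hu0 hvw
    simp only [HammockVAll, Set.mem_ofPred_eq] at huV haV
    refine hd_core_b l w k A D ?_ ?_ u v (by omega) (by omega) (by omega) hw ?_ a b ha0 (by omega) hbl hab
    · intro x y h; exact mem_hdCells.1 (hA h)
    · intro x y h
      have := h1 x y h
      rw [Finset.mem_sdiff, mem_hdCells] at this
      tauto
    · intro x y h
      exact h2 x y (by omega)
  · intro hV
    by_contra hH
    obtain ⟨S, hS⟩ : ∃ S : ℤ × ℤ → Prop, S = fun c => ∃ a : ℤ × ℤ, (a ∈ HammockVAll l w ∧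
      (a.1 + a.2 + k) % 2 = 0 ∧ a.1 = 0) ∧ Relation.ReflTransGen (HDStep k A) a c := ⟨_, rfl⟩
    obtain ⟨T, hT⟩ : ∃ T : ℤ × ℤ → Prop, T = fun c => ∃ a : ℤ × ℤ, (a ∈ HammockVAll l w ∧
      (a.1 + a.2 + (k + 1)) % 2 = 0 ∧ a.2 = 0) ∧
        Relation.ReflTransGen (HDStep (k + 1) (hdCells l w \ A)) a c := ⟨_, rfl⟩
    have Sstep : ∀ c e, HDStep k A c e → (S c ↔ S e) := by
      intro c e h
      rw [hS]
      constructor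
      · rintro ⟨a, ha, hac⟩; exact ⟨a, ha, hac.tail h⟩
      · rintro ⟨a, ha, hac⟩; exact ⟨a, ha, hac.tail h.symm⟩
    have Tstep : ∀ c e, HDStep (k + 1) (hdCells l w \ A) c e → (T c ↔ T e) := by
      intro c e h
      rw [hT]
      constructor
      · rintro ⟨a, ha, hac⟩; exact ⟨a, ha, hac.tail h⟩
      · rintro ⟨a, ha, hac⟩; exact ⟨a, ha, hac.tail h.symm⟩
    have S0 : ∀ y : ℤ, 0 ≤ y → y ≤ w → (0 + y + k) % 2 = 0 → S (0, y) := by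
      intro y h1 h2 h3
      rw [hS]
      exact ⟨(0, y), ⟨by simp [HammockVAll]; omega, h3, rfl⟩, .refl⟩
    have T0 : ∀ x : ℤ, 0 ≤ x → x ≤ l → (x + 0 + (k + 1)) % 2 = 0 → T (x, 0) := by
      intro x h1 h2 h3
      rw [hT]
      exact ⟨(x, 0), ⟨by simp [HammockVAll]; omega, h3, rfl⟩, .refl⟩
    have Sl : ∀ y : ℤ, 0 ≤ y → y ≤ w → (l + y + k) % 2 = 0 → ¬ S (l, y) := by
      intro y h1 h2 h3 hs
      rw [hS] at hs
      obtain ⟨a, ha, hac⟩ := hs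
      exact hH ⟨a, (l, y), ha, ⟨by simp [HammockVAll]; omega, h3, rfl⟩, hac⟩
    have Tl : ∀ x : ℤ, 0 ≤ x → x ≤ l → (x + w + (k + 1)) % 2 = 0 → ¬ T (x, w) := by
      intro x h1 h2 h3 hs
      rw [hT] at hs
      obtain ⟨a, ha, hac⟩ := hs
      exact hV ⟨a, (x, w), ha, ⟨by simp [HammockVAll]; omega, h3, rfl⟩, hac⟩
    by_cases hl : 0 < l
    swap
    · have hl0 : l = 0 := by omega
      subst hl0
      rcases Int.emod_two_eq_zero_or_one k with h | h
      · exact Sl 0 le_rfl (by omega) (by simpa using h) (S0 0 le_rfl (by omega) (by simpa using h))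
      · exact Sl 1 (by omega) (by omega) (by push_cast; omega) (S0 1 (by omega) (by omega) (by omega))
    obtain ⟨s, hs⟩ : ∃ s : ℤ → ℤ → ZMod 2, s = fun x y =>
      if x ≤ 0 then 1 else if (l : ℤ) ≤ x then 0 else if S (x, y) then 1 else 0 := ⟨_, rfl⟩
    obtain ⟨t, ht⟩ : ∃ t : ℤ → ℤ → ZMod 2, t = fun x y =>
      if y ≤ 0 then 1 else if (w : ℤ) ≤ y then 0 else if T (x, y) then 1 else 0 := ⟨_, rfl⟩
    have sS : ∀ x y : ℤ, 0 ≤ x → x ≤ l → 0 ≤ y → y ≤ w → (x + y + k) % 2 = 0 →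
        s x y = if S (x, y) then 1 else 0 := by
      intro x y h1 h2 h3 h4 h5
      rw [hs]
      by_cases hx : x ≤ 0
      · obtain rfl : x = 0 := by omega
        simp [S0 y h3 h4 h5]
      · by_cases hx' : (l : ℤ) ≤ x
        · obtain rfl : x = l := by omega
          simp [Sl y h3 h4 h5, hl]
          omega
        · simp [hx, hx']
    have tT : ∀ x y : ℤ, 0 ≤ x → x ≤ l → 0 ≤ y → y ≤ w → (x + y + (k + 1)) % 2 = 0 →
        t x y = if T (x, y) then 1 else 0 := by
      intro x y h1 h2 h3 h4 h5
      rw [ht]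
      by_cases hx : y ≤ 0
      · obtain rfl : y = 0 := by omega
        simp [T0 x h1 h2 h5]
      · by_cases hx' : (w : ℤ) ≤ y
        · obtain rfl : y = w := by omega
          simp [Tl x h1 h2 h5, hw]
          omega
        · simp [hx, hx']
    refine hd_core_a l w hw k s t ?_ ?_ ?_ ?_ ?_ ?_
    · intro x y h; simp [hs, h]
    · intro x y h; rw [hs]; simp only []; rw [if_neg (by omega), if_pos h]
    · intro x y h; simp [ht, h]
    · intro x y h; rw [ht]; simp only []; rw [if_neg (by omega), if_pos h]
    · intro x y h1 h2 h3 h4 h5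
      by_cases hxy : (x, y) ∈ A
      · left
        rw [sS _ _ h1 (by omega) h3 (by omega) h5,
          sS _ _ (by omega) (by omega) (by omega) (by omega) (by omega)]
        simp only [Sstep (x, y) (x + 1, y + 1) ⟨h5, x, y, hxy, by tauto⟩]
      · right
        have hm : (x, y) ∈ hdCells l w \ A := by
          rw [Finset.mem_sdiff, mem_hdCells]; tauto
        rw [tT _ _ (by omega) (by omega) h3 (by omega) (by omega),
          tT _ _ (by omega) (by omega) (by omega) (by omega) (by omega)]
        simp only [Tstep (x + 1, y) (x, y + 1) ⟨by simp only; omega, x, y, hm, by tauto⟩]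
    · intro x y h1 h2 h3 h4 h5
      by_cases hxy : (x, y) ∈ A
      · left
        rw [sS _ _ (by omega) (by omega) h3 (by omega) (by omega),
          sS _ _ (by omega) (by omega) (by omega) (by omega) (by omega)]
        simp only [Sstep (x + 1, y) (x, y + 1) ⟨by simp only; omega, x, y, hxy, by tauto⟩]
      · right
        have hm : (x, y) ∈ hdCells l w \ A := by
          rw [Finset.mem_sdiff, mem_hdCells]; tauto
        rw [tT _ _ (by omega) (by omega) h3 (by omega) (by omega),
          tT _ _ (by omega) (by omega) (by omega) (by omega) (by omega)]
        simp only [Tstep (x, y) (x + 1, y + 1) ⟨by simp only; omega, x, y, hm, by tauto⟩]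

/-- Quarter turn of the cells. -/
def hdRot (l : ℕ) (c : ℤ × ℤ) : ℤ × ℤ := (c.2, l - 1 - c.1)

theorem hdRot_inj (l : ℕ) : Function.Injective (hdRot l) := by
  rintro ⟨a, b⟩ ⟨c, d⟩ h
  simp only [hdRot, Prod.mk.injEq] at h ⊢
  omega

theorem mem_image_hdRot {l : ℕ} {B : Finset (ℤ × ℤ)} {x y : ℤ} :
    (x, y) ∈ B.image (hdRot l) ↔ (l - 1 - y, x) ∈ B := by
  rw [Finset.mem_image]
  constructor
  · rintro ⟨⟨a, b⟩, h, h'⟩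
    simp only [hdRot, Prod.mk.injEq] at h'
    obtain ⟨rfl, rfl⟩ := h'
    simpa using h
  · intro h
    exact ⟨_, h, by simp [hdRot]⟩

theorem hdCells_image_rot (l w : ℕ) : (hdCells l w).image (hdRot l) = hdCells w l := by
  ext ⟨x, y⟩
  rw [mem_image_hdRot, mem_hdCells, mem_hdCells]
  omega

theorem hd_rot (l w : ℕ) (hl : Odd l) (k : ℤ) (B : Finset (ℤ × ℤ)) :
    HDVConn (k + 1) l w B ↔ HDConn k w l (B.image (hdRot l)) := by
  obtain ⟨m, rfl⟩ := hl
  constructor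
  · rintro ⟨a, b, ⟨haV, hap, ha0⟩, ⟨hbV, hbp, hbl⟩, hab⟩
    simp only [HammockVAll, Set.mem_ofPred_eq] at haV hbV
    push_cast at haV hbV
    refine ⟨(a.2, (2 * m + 1 : ℕ) - a.1), (b.2, (2 * m + 1 : ℕ) - b.1), ⟨?_, ?_, ha0⟩, ⟨?_, ?_, hbl⟩, ?_⟩
    · simp [HammockVAll]; omega
    · simp only; push_cast; omega
    · simp [HammockVAll]; omega
    · simp only; push_cast; omega
    · refine Relation.ReflTransGen.lift (fun c : ℤ × ℤ => (c.2, ((2 * m + 1 : ℕ) : ℤ) - c.1)) ?_ a b hab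
      rintro a b ⟨hp, x, y, hB, h⟩
      refine ⟨by simp only; push_cast; omega, y, (2 * m + 1 : ℕ) - 1 - x, ?_, ?_⟩
      · rw [mem_image_hdRot]; simpa using hB
      · rcases h with ⟨rfl, rfl⟩ | ⟨rfl, rfl⟩ | ⟨rfl, rfl⟩ | ⟨rfl, rfl⟩ <;>
          simp [add_comm, sub_sub] <;> omega
  · rintro ⟨a, b, ⟨haV, hap, ha0⟩, ⟨hbV, hbp, hbl⟩, hab⟩
    simp only [HammockVAll, Set.mem_ofPred_eq] at haV hbV
    push_cast at haV hbV
    refine ⟨((2 * m + 1 : ℕ) - a.2, a.1), ((2 * m + 1 : ℕ) - b.2, b.1), ⟨?_, ?_, ha0⟩, ⟨?_, ?_, hbl⟩, ?_⟩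
    · simp [HammockVAll]; omega
    · simp only; push_cast; omega
    · simp [HammockVAll]; omega
    · simp only; push_cast; omega
    · refine Relation.ReflTransGen.lift (fun c : ℤ × ℤ => (((2 * m + 1 : ℕ) : ℤ) - c.2, c.1)) ?_ a b hab
      rintro a b ⟨hp, x, y, hB, h⟩
      rw [mem_image_hdRot] at hB
      refine ⟨by simp only; push_cast; omega, _, _, hB, ?_⟩
      rcases h with ⟨rfl, rfl⟩ | ⟨rfl, rfl⟩ | ⟨rfl, rfl⟩ | ⟨rfl, rfl⟩ <;>
          simp [add_comm, sub_sub] <;> omega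

/-- The diagonal of kind `k` in a cell. -/
def hdEdge (k : ℤ) (c : ℤ × ℤ) : Sym2 (ℤ × ℤ) :=
  if (c.1 + c.2 + k) % 2 = 0 then s((c.1, c.2), (c.1 + 1, c.2 + 1))
  else s((c.1 + 1, c.2), (c.1, c.2 + 1))

theorem hdEdge_inj (k : ℤ) : Function.Injective (hdEdge k) := by
  rintro ⟨a, b⟩ ⟨c, d⟩ h
  simp only [hdEdge] at h
  split_ifs at h <;> simp only [Sym2.eq_iff, Prod.mk.injEq] at h ⊢ <;> omega

theorem hdStep_iff (k : ℤ) (A : Finset (ℤ × ℤ)) (a b : ℤ × ℤ) :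
    HDStep k A a b ↔ s(a, b) ∈ A.image (hdEdge k) := by
  rw [Finset.mem_image]
  constructor
  · rintro ⟨hp, x, y, hA, h⟩
    refine ⟨(x, y), hA, ?_⟩
    rcases h with ⟨rfl, rfl⟩ | ⟨rfl, rfl⟩ | ⟨rfl, rfl⟩ | ⟨rfl, rfl⟩ <;> simp only [hdEdge] at hp ⊢
    · rw [if_pos (by omega)]
    · rw [if_pos (by omega), Sym2.eq_swap]
    · rw [if_neg (by omega)]
    · rw [if_neg (by omega), Sym2.eq_swap]
  · rintro ⟨⟨x, y⟩, hA, h⟩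
    simp only [hdEdge] at h
    split_ifs at h with hp <;> rw [Sym2.eq_iff] at h <;>
      rcases h with ⟨rfl, rfl⟩ | ⟨rfl, rfl⟩
    · exact ⟨hp, x, y, hA, by tauto⟩
    · exact ⟨by simp only; omega, x, y, hA, by tauto⟩
    · exact ⟨by simp only; omega, x, y, hA, by tauto⟩
    · exact ⟨by simp only; omega, x, y, hA, by tauto⟩

theorem hdPar_iff (i : ℕ) (hi : i = 1 ∨ i = 2) (p : ℤ × ℤ) :
    HammockPar i p ↔ (p.1 + p.2 + ((i : ℤ) - 1)) % 2 = 0 := by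
  rcases hi with rfl | rfl
  · simp only [HammockPar, if_true, Int.even_iff]; push_cast; simp
  · simp only [HammockPar, Int.odd_iff]; norm_num; omega

theorem hammockEFinset_eq (i l w : ℕ) (hi : i = 1 ∨ i = 2) :
    hammockEFinset i l w = (hdCells l w).image (hdEdge ((i : ℤ) - 1)) := by
  ext e
  have hE : e ∈ HammockE i l w ↔ e ∈ (hdCells l w).image (hdEdge ((i : ℤ) - 1)) := by
    constructor
    · rintro ⟨⟨⟨x, y⟩, ⟨x', y'⟩, rfl, ha, hb, h1, h2⟩, hp⟩
      have hpa := hp (x, y) (by simp)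
      rw [hdPar_iff i hi] at hpa
      rw [← hdStep_iff]
      simp only [HammockVAll, Set.mem_ofPred_eq] at ha hb h1 h2 hpa
      have hx : x' = x + 1 ∨ x' = x - 1 := by
        rcases (abs_eq (by norm_num)).1 h1 with h | h <;> omega
      have hy : y' = y + 1 ∨ y' = y - 1 := by
        rcases (abs_eq (by norm_num)).1 h2 with h | h <;> omega
      rcases hx with rfl | rfl <;> rcases hy with rfl | rfl
      · exact ⟨hpa, x, y, by rw [mem_hdCells]; omega, by simp⟩
      · exact ⟨hpa, x, y - 1, by rw [mem_hdCells]; omega, by simp⟩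
      · exact ⟨hpa, x - 1, y, by rw [mem_hdCells]; omega, by simp⟩
      · exact ⟨hpa, x - 1, y - 1, by rw [mem_hdCells]; omega, by simp⟩
    · induction e with | _ a b =>
      rw [← hdStep_iff]
      intro h
      have hpb := h.symm.1
      obtain ⟨hpa, x, y, hA, h⟩ := h
      rw [mem_hdCells] at hA
      refine ⟨⟨a, b, rfl, ?_, ?_, ?_, ?_⟩, ?_⟩
      · rcases h with ⟨rfl, rfl⟩ | ⟨rfl, rfl⟩ | ⟨rfl, rfl⟩ | ⟨rfl, rfl⟩ <;>
          simp only [HammockVAll, Set.mem_ofPred_eq] <;> omega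
      · rcases h with ⟨rfl, rfl⟩ | ⟨rfl, rfl⟩ | ⟨rfl, rfl⟩ | ⟨rfl, rfl⟩ <;>
          simp only [HammockVAll, Set.mem_ofPred_eq] <;> omega
      · rcases h with ⟨rfl, rfl⟩ | ⟨rfl, rfl⟩ | ⟨rfl, rfl⟩ | ⟨rfl, rfl⟩ <;> simp
      · rcases h with ⟨rfl, rfl⟩ | ⟨rfl, rfl⟩ | ⟨rfl, rfl⟩ | ⟨rfl, rfl⟩ <;> simp
      · intro p hp
        rw [hdPar_iff i hi]
        rw [Sym2.mem_iff] at hp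
        rcases hp with rfl | rfl <;> assumption
  rw [← hE, hammockEFinset, Finset.mem_filter]
  refine ⟨fun h => h.2, fun h => ⟨?_, h⟩⟩
  obtain ⟨⟨a, b, rfl, ha, hb, _⟩, _⟩ := h
  simp only [HammockVAll, Set.mem_ofPred_eq] at ha hb
  rw [Finset.mk_mem_sym2_iff]
  simp only [Finset.mem_product, Finset.mem_Icc]
  omega

theorem hd_xEdges (P : Set (Sym2 (ℤ × ℤ))) : ∀ vs : List (ℤ × ℤ),
    (∀ e ∈ xEdges vs, e ∈ P) ↔ vs.IsChain (fun a b => s(a, b) ∈ P)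
  | [] => by simp [xEdges]
  | [a] => by simp [xEdges]
  | a :: b :: t => by
    have ih := hd_xEdges P (b :: t)
    rw [List.isChain_cons_cons, ← ih]
    simp [xEdges]

theorem hd_nodup_path {α : Type*} (r : α → α → Prop) (a b : α)
    (h : Relation.ReflTransGen r a b) :
    ∃ (vs : List α) (hne : vs ≠ []), vs.Nodup ∧ vs.IsChain r ∧ vs.head hne = a ∧
      vs.getLast hne = b := by
  induction h using Relation.ReflTransGen.head_induction_on with
  | refl => exact ⟨[b], by simp, by simp, by simp, rfl, rfl⟩
  | @head a c hac _ ih =>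
    obtain ⟨vs, hne, hnd, hch, hh, hl⟩ := ih
    by_cases ha : a ∈ vs
    · obtain ⟨p, q, rfl⟩ := List.append_of_mem ha
      refine ⟨a :: q, by simp, ?_, ?_, rfl, ?_⟩
      · exact (List.nodup_append.1 hnd).2.1
      · exact (List.isChain_append.1 hch).2.1
      · rw [← hl, List.getLast_append_of_ne_nil]
    · refine ⟨a :: vs, by simp, by simp [ha, hnd], ?_, rfl, ?_⟩
      · cases vs with
        | nil => simp
        | cons d t =>
          simp only [List.head_cons] at hh
          subst hh
          exact List.isChain_cons_cons.2 ⟨hac, hch⟩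
      · rw [List.getLast_cons hne, hl]

theorem hd_chain_reach {α : Type*} (r : α → α → Prop) : ∀ (vs : List α) (hne : vs ≠ []),
    vs.IsChain r → Relation.ReflTransGen r (vs.head hne) (vs.getLast hne)
  | [a], _, _ => .refl
  | a :: b :: t, _, h => by
    rw [List.isChain_cons_cons] at h
    have := hd_chain_reach r (b :: t) (by simp) h.2
    simp only [List.head_cons, List.getLast_cons_cons] at this ⊢
    exact .head h.1 this

theorem hd_pathset_iff (i l w : ℕ) (hi : i = 1 ∨ i = 2) (A : Finset (ℤ × ℤ))
    (hA : A ⊆ hdCells l w) :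
    (hammock i l w).IsPathset ↑(A.image (hdEdge ((i : ℤ) - 1))) ↔
      HDConn ((i : ℤ) - 1) l w A := by
  have hsrc : ∀ a, (a ∈ HammockV i l w ↔ a ∈ HammockVAll l w ∧
      (a.1 + a.2 + ((i : ℤ) - 1)) % 2 = 0) := by
    intro a; rw [← hdPar_iff i hi]; rfl
  constructor
  · rintro ⟨_, vs, hne, _, hs, ht, he⟩
    rw [hd_xEdges] at he
    have hr := hd_chain_reach _ vs hne he
    refine ⟨_, _, ⟨((hsrc _).1 hs.1).1, ((hsrc _).1 hs.1).2, hs.2⟩,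
      ⟨((hsrc _).1 ht.1).1, ((hsrc _).1 ht.1).2, ht.2⟩, ?_⟩
    refine Relation.ReflTransGen.mono ?_ _ _ hr
    intro a b h
    rw [hdStep_iff]
    exact_mod_cast h
  · rintro ⟨a, b, ⟨h1, h2, h3⟩, ⟨h4, h5, h6⟩, hr⟩
    constructor
    · intro e he
      have he' : e ∈ hammockEFinset i l w := by
        rw [hammockEFinset_eq i l w hi]
        exact Finset.image_subset_image hA (by exact_mod_cast he)
      exact (Finset.mem_filter.1 he').2
    · obtain ⟨vs, hne, hnd, hch, hh, hl⟩ := hd_nodup_path _ _ _ hr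
      refine ⟨vs, hne, ⟨hnd, ?_⟩, ?_, ?_, ?_⟩
      · refine List.IsChain.imp ?_ hch
        rintro a b ⟨_, x, y, _, h⟩
        rcases h with ⟨rfl, rfl⟩ | ⟨rfl, rfl⟩ | ⟨rfl, rfl⟩ | ⟨rfl, rfl⟩ <;> simp [XStep]
      · rw [hh]; exact ⟨(hsrc _).2 ⟨h1, h2⟩, h3⟩
      · rw [hl]; exact ⟨(hsrc _).2 ⟨h4, h5⟩, h6⟩
      · rw [hd_xEdges]
        refine List.IsChain.imp ?_ hch
        intro a b h
        rw [hdStep_iff] at h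
        exact_mod_cast h

theorem hammockRel_eq (i l w : ℕ) (hi : i = 1 ∨ i = 2) (p : ℝ) :
    hammockRel i l w p = ∑ A ∈ (hdCells l w).powerset,
      if HDConn ((i : ℤ) - 1) l w A then p ^ A.card * (1 - p) ^ (l * w - A.card) else 0 := by
  rw [hammockRel, hammockEFinset_eq i l w hi, Finset.powerset_image, Finset.sum_filter,
    Finset.sum_image]
  · refine Finset.sum_congr rfl ?_
    intro A hA
    rw [Finset.mem_powerset] at hA
    rw [Finset.card_image_of_injective _ (hdEdge_inj _)]
    simp only [hd_pathset_iff i l w hi A hA]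
  · intro A _ B _ h
    exact Finset.image_injective (hdEdge_inj _) h

theorem hdCells_card (l w : ℕ) : (hdCells l w).card = l * w := by
  simp [hdCells]

theorem hd_odd_left (l w : ℕ) (hw : 0 < w) (hl : Odd l) (p : ℝ) (i : ℕ) (hi : i = 1 ∨ i = 2) :
    hammockRel i l w p = 1 - hammockRel i w l (1 - p) := by
  have tot : ∑ A ∈ (hdCells l w).powerset, p ^ A.card * (1 - p) ^ (l * w - A.card) = 1 := by
    have := Finset.sum_pow_mul_eq_add_pow p (1 - p) (hdCells l w)
    rw [hdCells_card] at this
    rw [this]; simp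
  have h2 : hammockRel i w l (1 - p) = ∑ A ∈ (hdCells l w).powerset,
      if HDConn ((i : ℤ) - 1) l w A then 0 else p ^ A.card * (1 - p) ^ (l * w - A.card) := by
    rw [hammockRel_eq i w l hi]
    symm
    refine Finset.sum_bij (fun A _ => (hdCells l w \ A).image (hdRot l)) ?_ ?_ ?_ ?_
    · intro A _
      rw [Finset.mem_powerset, ← hdCells_image_rot l w]
      exact Finset.image_subset_image Finset.sdiff_subset
    · intro A hA B hB h
      rw [Finset.mem_powerset] at hA hB
      have := Finset.image_injective (hdRot_inj l) h
      rw [← Finset.sdiff_sdiff_eq_self hA, this, Finset.sdiff_sdiff_eq_self hB]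
    · intro B hB
      rw [Finset.mem_powerset, ← hdCells_image_rot l w, Finset.subset_image_iff] at hB
      obtain ⟨C, hC, rfl⟩ := hB
      refine ⟨hdCells l w \ C, by simp, ?_⟩
      rw [Finset.sdiff_sdiff_eq_self (by exact_mod_cast hC)]
    · intro A hA
      rw [Finset.mem_powerset] at hA
      have hd := hd_dual l w hw ((i : ℤ) - 1) A hA
      rw [hd_rot l w hl] at hd
      have hc : (hdCells l w \ A).card = l * w - A.card := by
        rw [Finset.card_sdiff_of_subset hA, hdCells_card]
      have hle : A.card ≤ l * w := by
        rw [← hdCells_card]; exact Finset.card_le_card hA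
      rw [Finset.card_image_of_injective _ (hdRot_inj l), hc, mul_comm w l, Nat.sub_sub_self hle,
        sub_sub_cancel]
      by_cases h : HDConn ((i : ℤ) - 1) l w A
      · rw [if_pos h, if_neg (hd.1 h)]
      · rw [if_neg h, if_pos (by tauto), mul_comm]
  rw [h2, hammockRel_eq i l w hi, eq_sub_iff_add_eq, ← Finset.sum_add_distrib]
  refine Eq.trans ?_ tot
  refine Finset.sum_congr rfl ?_
  intro A _
  split_ifs <;> simp

/-- If at least one of l, w is odd (so that the two kinds give the same
reliability polynomial h_{l,w}), then for every p ∈ [0,1],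
h_{l,w}(p) = 1 − h_{w,l}(1 − p). -/
theorem hammockRel_dual_odd (l w : ℕ) (hl : 0 < l) (hw : 0 < w)
    (hodd : Odd l ∨ Odd w) (p : ℝ) (hp0 : 0 ≤ p) (hp1 : p ≤ 1) :
    ∀ i : ℕ, i = 1 ∨ i = 2 → hammockRel i l w p = 1 - hammockRel i w l (1 - p) := by
  intro i hi
  rcases hodd with h | h
  · exact hd_odd_left l w hw h p i hi
  · have := hd_odd_left w l hl h (1 - p) i hi
    rw [sub_sub_cancel] at this
    rw [this]; ring
end
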